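/- Let (R, 𝔪, k) be a Cohen-Macaulay Noetherian local ring of Krull dimension d ≥ 2 with a canonical module ω_R. Let M be a finitely generated R-module with dim_R M = d such that M ⊗_R ω_R is generalized Cohen-Macaulay, and let λM := image(f* : Hom_R(F₀,R) → Hom_R(F₁,R)) for a finite free presentation F₁ →f F₀ → M → 0. Then for each i = 1, …, d−1 there is an isomorphism H^i_𝔪(M ⊗_R ω_R) ≅ Hom_R(H^{d−i}_𝔪(λM), E(k)), where E(k) is an injective hull of the residue field k. -/

import Mathlib

open CategoryTheory Opposite IsLocalRing

/-- The Ext module `Ext^i_R(M, N)` as an object of `ModuleCat R`. -/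
noncomputable def extMod (R : Type) [CommRing R] (M N : Type) [AddCommGroup M] [Module R M]
    [AddCommGroup N] [Module R N] (i : ℕ) : ModuleCat R :=
  ((Ext R (ModuleCat R) i).obj (op (ModuleCat.of R M))).obj (ModuleCat.of R N)

/-- The Tor module `Tor_i^R(M, N)` as an object of `ModuleCat R`. -/
noncomputable def torMod (R : Type) [CommRing R] (M N : Type) [AddCommGroup M] [Module R M]
    [AddCommGroup N] [Module R N] (i : ℕ) : ModuleCat R :=
  ((Tor (ModuleCat R) i).obj (ModuleCat.of R M)).obj (ModuleCat.of R N)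

/-- The depth of a module over a Noetherian local ring: the least `i` such that
`Ext^i_R(k, M) ≠ 0`, with the convention `depth 0 = ⊤` (as `sInf ∅ = ⊤` in `ℕ∞`). -/
noncomputable def rdepth (R : Type) [CommRing R] [IsLocalRing R] (M : Type) [AddCommGroup M]
    [Module R M] : ℕ∞ :=
  sInf {n : ℕ∞ | ∃ i : ℕ, Nontrivial (extMod R (ResidueField R) M i) ∧ n = i}

/-- The Krull dimension of a module: `dim R⧸Ann M`. -/
noncomputable def mdim (R : Type) [CommRing R] (M : Type) [AddCommGroup M] [Module R M] :
    WithBot ℕ∞ :=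
  ringKrullDim (R ⧸ Module.annihilator R M)

/-- `M` is Cohen-Macaulay of dimension `n`: depth and dimension both equal `n`. -/
def isCMofDim (R : Type) [CommRing R] [IsLocalRing R] (M : Type) [AddCommGroup M] [Module R M]
    (n : ℕ) : Prop :=
  rdepth R M = (n : ℕ∞) ∧ mdim R M = (n : ℕ)

/-- `M` is Cohen-Macaulay: depth equals dimension. -/
def isCM (R : Type) [CommRing R] [IsLocalRing R] (M : Type) [AddCommGroup M] [Module R M] : Prop :=
  (rdepth R M : WithBot ℕ∞) = mdim R M

/-- `R` is a Cohen-Macaulay local ring of dimension `d`. -/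
def isCMLocalRing (R : Type) [CommRing R] [IsLocalRing R] (d : ℕ) : Prop :=
  ringKrullDim R = (d : ℕ) ∧ rdepth R R = (d : ℕ∞)

/-- `M` has Sliding Depth of Extension modules: for `1 ≤ i ≤ d-1`, either `Ext^i(M,R) = 0`
or `depth Ext^i(M,R) ≥ d - i`. -/
def isSDE (R : Type) [CommRing R] [IsLocalRing R] (M : Type) [AddCommGroup M] [Module R M]
    (d : ℕ) : Prop :=
  ∀ i : ℕ, 1 ≤ i → i ≤ d - 1 →
    Subsingleton (extMod R M R i) ∨ ((d - i : ℕ) : ℕ∞) ≤ rdepth R (extMod R M R i)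

/-- `M` has Cohen-Macaulay Extension modules: for `1 ≤ i ≤ d-1`, either `Ext^i(M,R) = 0`
or `Ext^i(M,R)` is Cohen-Macaulay of dimension `d - i`. -/
def isCME (R : Type) [CommRing R] [IsLocalRing R] (M : Type) [AddCommGroup M] [Module R M]
    (d : ℕ) : Prop :=
  ∀ i : ℕ, 1 ≤ i → i ≤ d - 1 →
    Subsingleton (extMod R M R i) ∨ isCMofDim R (extMod R M R i) (d - i)

/-- `M` is sequentially Cohen-Macaulay: it has a filtration with Cohen-Macaulay quotients
of strictly increasing dimensions. -/
def isSeqCM (R : Type) [CommRing R] [IsLocalRing R] (M : Type) [AddCommGroup M] [Module R M] :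
    Prop :=
  ∃ (r : ℕ) (Φ : Fin (r + 1) → Submodule R M), Φ 0 = ⊥ ∧ Φ (Fin.last r) = ⊤ ∧ StrictMono Φ ∧
    (∀ i : Fin r, isCM R (↥(Φ i.succ) ⧸ (Φ i.castSucc).comap (Φ i.succ).subtype)) ∧
    (∀ i j : Fin r, i < j →
      mdim R (↥(Φ i.succ) ⧸ (Φ i.castSucc).comap (Φ i.succ).subtype) <
      mdim R (↥(Φ j.succ) ⧸ (Φ j.castSucc).comap (Φ j.succ).subtype))

/-- `ω` is a canonical module of the `d`-dimensional local ring `R`: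
`Ext^i_R(k, ω) = 0` for `i ≠ d` and `Ext^d_R(k, ω) ≅ k`. -/
def isCanonicalModule (R : Type) [CommRing R] [IsLocalRing R] (d : ℕ) (ω : Type)
    [AddCommGroup ω] [Module R ω] : Prop :=
  Module.Finite R ω ∧ (∀ i : ℕ, i ≠ d → Subsingleton (extMod R (ResidueField R) ω i)) ∧
    Nonempty ((extMod R (ResidueField R) ω d) ≃ₗ[R] ResidueField R)

/-- The local cohomology module `H^i_𝔪(M)` supported at the maximal ideal. -/
noncomputable def lcMod (R : Type) [CommRing R] [IsLocalRing R] (i : ℕ) (M : Type)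
    [AddCommGroup M] [Module R M] : ModuleCat R :=
  (localCohomology (maximalIdeal R) i).obj (ModuleCat.of R M)

/-- The 𝔪-torsion submodule `Γ_𝔪(M) = {x ∈ M | 𝔪^n x = 0 for some n}`. -/
noncomputable def mTorsion (R : Type) [CommRing R] [IsLocalRing R] (M : Type) [AddCommGroup M]
    [Module R M] : Submodule R M :=
  ⨆ n : ℕ, Submodule.torsionBySet R M ((maximalIdeal R ^ n : Ideal R) : Set R)

/-- The natural evaluation (biduality) map `M → Hom_R(Hom_R(M, ω), ω)`. -/
noncomputable def evMap (R : Type) [CommRing R] (M ω : Type) [AddCommGroup M] [Module R M]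
    [AddCommGroup ω] [Module R ω] : M →ₗ[R] ((M →ₗ[R] ω) →ₗ[R] ω) :=
  (LinearMap.id : (M →ₗ[R] ω) →ₗ[R] (M →ₗ[R] ω)).flip

/-- Serre's condition `(S₂)` on the punctured spectrum. -/
def serreS2Punctured (R : Type) [CommRing R] [IsLocalRing R] (M : Type) [AddCommGroup M]
    [Module R M] : Prop :=
  ∀ (𝔭 : Ideal R) [𝔭.IsPrime], 𝔭 ≠ maximalIdeal R →
    min (2 : WithBot ℕ∞) (mdim (Localization.AtPrime 𝔭) (LocalizedModule 𝔭.primeCompl M)) ≤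
      (rdepth (Localization.AtPrime 𝔭) (LocalizedModule 𝔭.primeCompl M) : WithBot ℕ∞)

namespace CategoryTheory.ProjectiveResolution

open CochainComplex HomComplex in
lemma extMk_zero_degree_eq_zero_iff {C : Type*} [Category* C] [Abelian C]
    [HasExt C] {X Y : C} (P : ProjectiveResolution X)
    (f : P.complex.X 0 ⟶ Y) (hf : P.complex.d 1 0 ≫ f = 0) :
    P.extMk f 1 rfl hf = 0 ↔ f = 0 := by
  refine ⟨fun h => ?_, fun h => by subst h; simp⟩
  rw [← P.extEquivCohomologyClass.apply_eq_iff_eq,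
    extEquivCohomologyClass_extMk, extEquivCohomologyClass_zero,
    CohomologyClass.mk_eq_zero_iff, Cocycle.toSingleMk_mem_coboundaries_iff _ _ _ _ _ 1
      (by simp)] at h
  obtain ⟨g, hg⟩ := h
  have h0 : P.cochainComplex.d (-((0 : ℕ) : ℤ)) 1 = 0 := by
    apply Limits.IsZero.eq_zero_of_tgt
    exact P.cochainComplex.isZero_of_isStrictlyLE 0 1
  rw [h0, Limits.zero_comp] at hg
  rw [← cancel_epi (P.cochainComplexXIso (-((0 : ℕ) : ℤ)) 0 rfl).hom, ← hg, Limits.comp_zero]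

end CategoryTheory.ProjectiveResolution

namespace ModuleCat

variable {R : Type} [CommRing R]

/-- Two surjective linear maps with the same kernel have isomorphic targets. -/
noncomputable def equivOfSurjective {Z A B : Type} [AddCommGroup Z] [Module R Z]
    [AddCommGroup A] [Module R A] [AddCommGroup B] [Module R B] (q : Z →ₗ[R] A) (e : Z →ₗ[R] B)
    (hq : Function.Surjective q) (he : Function.Surjective e)
    (h : LinearMap.ker q = LinearMap.ker e) : A ≃ₗ[R] B :=
  (q.quotKerEquivOfSurjective hq).symm ≪≫ₗ Submodule.quotEquivOfEq _ _ h ≪≫ₗ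
    e.quotKerEquivOfSurjective he

lemma equivOfSurjective_apply {Z A B : Type} [AddCommGroup Z] [Module R Z]
    [AddCommGroup A] [Module R A] [AddCommGroup B] [Module R B] (q : Z →ₗ[R] A) (e : Z →ₗ[R] B)
    (hq : Function.Surjective q) (he : Function.Surjective e)
    (h : LinearMap.ker q = LinearMap.ker e) (z : Z) :
    equivOfSurjective q e hq he h (q z) = e z := by
  have : (q.quotKerEquivOfSurjective hq).symm (q z) = Submodule.Quotient.mk z := by
    rw [LinearEquiv.symm_apply_eq]; rfl
  simp only [equivOfSurjective, LinearEquiv.trans_apply, this]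
  rfl

/-- The functor `Hom(-, Y)` with values in the opposite category. -/
noncomputable abbrev homOp (Y : ModuleCat.{0} R) : ModuleCat.{0} R ⥤ (ModuleCat.{0} R)ᵒᵖ :=
  ((linearYoneda R (ModuleCat R)).obj Y).rightOp

/-- The complex `Hom(P, Y)` in the opposite category. -/
noncomputable abbrev homOpComplex {A : ModuleCat.{0} R} (P : ProjectiveResolution A)
    (Y : ModuleCat.{0} R) : ChainComplex (ModuleCat.{0} R)ᵒᵖ ℕ :=
  ((homOp Y).mapHomologicalComplex (ComplexShape.down ℕ)).obj P.complex

variable {A A' : ModuleCat.{0} R} (P : ProjectiveResolution A) (P' : ProjectiveResolution A')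
  (Y : ModuleCat.{0} R) (n : ℕ)

/-- The cocycle underlying an element of the (op)cycles of `Hom(P, Y)`. -/
noncomputable def cocycleHom : ((homOpComplex P Y).opcycles n).unop →ₗ[R] (P.complex.X n ⟶ Y) :=
  ((homOpComplex P Y).pOpcycles n).unop.hom

lemma d_comp_cocycleHom (z : ((homOpComplex P Y).opcycles n).unop) :
    P.complex.d (n + 1) n ≫ cocycleHom P Y n z = 0 := by
  have := (homOpComplex P Y).d_pOpcycles (n + 1) n
  exact congrArg (fun f => f.unop.hom z) this

lemma cocycleHom_injective : Function.Injective (cocycleHom P Y n) := by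
  have : Mono ((homOpComplex P Y).pOpcycles n).unop := inferInstance
  exact (ModuleCat.mono_iff_injective _).1 this

lemma cocycleHom_surjective (f : P.complex.X n ⟶ Y) (hf : P.complex.d (n + 1) n ≫ f = 0) :
    ∃ z, cocycleHom P Y n z = f := by
  have h := (ShortComplex.exact_of_g_is_cokernel
    (.mk _ _ ((homOpComplex P Y).d_pOpcycles (n + 1) n))
    ((homOpComplex P Y).opcyclesIsCokernel (n + 1) n (by simp))).unop
  exact (ShortComplex.moduleCat_exact_iff _).1 h f hf

lemma cocycleHom_smul_extMk (f : P.complex.X n ⟶ Y) (hf : P.complex.d (n + 1) n ≫ f = 0) (r : R) :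
    P.extMk (r • f) (n + 1) rfl (by simp [hf]) = r • P.extMk f (n + 1) rfl hf := by
  rw [Abelian.Ext.smul_eq_comp_mk₀, ProjectiveResolution.extMk_comp_mk₀]
  simp

/-- The class of a cocycle in `Ext`. -/
noncomputable def cocycleExt : ((homOpComplex P Y).opcycles n).unop →ₗ[R] Abelian.Ext A Y n where
  toFun z := P.extMk (cocycleHom P Y n z) (n + 1) rfl (d_comp_cocycleHom P Y n z)
  map_add' z w := by
    simp only [map_add]
    rw [← ProjectiveResolution.add_extMk]
  map_smul' r z := by
    simp only [map_smul]
    exact cocycleHom_smul_extMk P Y n _ (d_comp_cocycleHom P Y n z) r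

lemma cocycleExt_surjective : Function.Surjective (cocycleExt P Y n) := by
  intro α
  obtain ⟨f, hf, rfl⟩ := P.extMk_surjective α (n + 1) rfl
  obtain ⟨z, rfl⟩ := cocycleHom_surjective P Y n f hf
  exact ⟨z, rfl⟩

/-- The class of a cocycle in the homology of `Hom(P, Y)`. -/
noncomputable def cocycleHomology :
    ((homOpComplex P Y).opcycles n).unop →ₗ[R] ((homOpComplex P Y).homology n).unop :=
  ((homOpComplex P Y).homologyι n).unop.hom

lemma cocycleHomology_surjective : Function.Surjective (cocycleHomology P Y n) := by
  have : Epi ((homOpComplex P Y).homologyι n).unop := inferInstance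
  exact (ModuleCat.epi_iff_surjective _).1 this

lemma cocycleHomology_eq_zero_iff (z : ((homOpComplex P Y).opcycles n).unop) :
    cocycleHomology P Y n z = 0 ↔ cocycleExt P Y n z = 0 := by
  obtain _ | p := n
  · change _ ↔ P.extMk _ _ rfl (d_comp_cocycleHom P Y 0 z) = 0
    rw [ProjectiveResolution.extMk_zero_degree_eq_zero_iff P _ (d_comp_cocycleHom P Y 0 z)]
    have : IsIso ((homOpComplex P Y).homologyι 0) :=
      (homOpComplex P Y).isIso_homologyι 0 _ rfl (by simp)
    have h : IsIso ((homOpComplex P Y).homologyι 0).unop := inferInstance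
    have h1 : Function.Injective (cocycleHomology P Y 0) :=
      ((ConcreteCategory.isIso_iff_bijective _).1 h).1
    rw [map_eq_zero_iff _ h1, map_eq_zero_iff _ (cocycleHom_injective P Y 0)]
  · change _ ↔ P.extMk _ _ rfl (d_comp_cocycleHom P Y (p + 1) z) = 0
    rw [ProjectiveResolution.extMk_eq_zero_iff P _ _ _ _ p rfl]
    have h := (ShortComplex.exact_of_f_is_kernel
      (.mk _ _ ((homOpComplex P Y).homologyι_comp_fromOpcycles (p + 1) p))
      ((homOpComplex P Y).homologyIsKernel (p + 1) p (by simp))).unop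
    have hd := (homOpComplex P Y).p_fromOpcycles (p + 1) p
    have hd' : ∀ g : P.complex.X p ⟶ Y, cocycleHom P Y (p + 1)
        (((homOpComplex P Y).fromOpcycles (p + 1) p).unop.hom g) = P.complex.d (p + 1) p ≫ g :=
      fun g => congrArg (fun f => f.unop.hom g) hd
    constructor
    · intro hz
      obtain ⟨g, hg⟩ := (ShortComplex.moduleCat_exact_iff _).1 h z hz
      exact ⟨g, (hd' g).symm.trans (congrArg _ hg)⟩
    · rintro ⟨g, hg⟩
      rw [← hd'] at hg
      rw [← cocycleHom_injective P Y _ hg]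
      have := (homOpComplex P Y).homologyι_comp_fromOpcycles (p + 1) p
      exact congrArg (fun f => f.unop.hom g) this

/-- Cocycles mapped to the derived functor `Ext`. -/
noncomputable def cocycleDerived :
    ((homOpComplex P Y).opcycles n).unop →ₗ[R]
      ((_root_.Ext R (ModuleCat.{0} R) n).obj (op A)).obj Y :=
  ((P.isoLeftDerivedObj (homOp Y) n).hom.unop).hom ∘ₗ cocycleHomology P Y n

lemma cocycleDerived_surjective : Function.Surjective (cocycleDerived P Y n) := by
  have : IsIso (P.isoLeftDerivedObj (homOp Y) n).hom.unop := inferInstance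
  exact ((ConcreteCategory.isIso_iff_bijective _).1 this).2.comp (cocycleHomology_surjective P Y n)

lemma cocycleDerived_eq_zero_iff (z : ((homOpComplex P Y).opcycles n).unop) :
    cocycleDerived P Y n z = 0 ↔ cocycleExt P Y n z = 0 := by
  have : IsIso (P.isoLeftDerivedObj (homOp Y) n).hom.unop := inferInstance
  rw [← cocycleHomology_eq_zero_iff]
  exact map_eq_zero_iff ((P.isoLeftDerivedObj (homOp Y) n).hom.unop).hom
    ((ConcreteCategory.isIso_iff_bijective _).1 this).1

/-- The `Ext` functor defined by deriving `Hom` agrees with `Abelian.Ext`. -/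
noncomputable def derivedExtEquiv (A Y : ModuleCat.{0} R) (n : ℕ) :
    ((_root_.Ext R (ModuleCat.{0} R) n).obj (op A)).obj Y ≃ₗ[R] Abelian.Ext A Y n :=
  equivOfSurjective (cocycleDerived (CategoryTheory.projectiveResolution A) Y n)
    (cocycleExt (CategoryTheory.projectiveResolution A) Y n)
    (cocycleDerived_surjective _ _ _) (cocycleExt_surjective _ _ _)
    (by ext z; exact cocycleDerived_eq_zero_iff _ _ _ z)

lemma derivedExtEquiv_cocycle
    (z : ((homOpComplex (CategoryTheory.projectiveResolution A) Y).opcycles n).unop) :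
    derivedExtEquiv A Y n (cocycleDerived (CategoryTheory.projectiveResolution A) Y n z) =
      cocycleExt (CategoryTheory.projectiveResolution A) Y n z :=
  equivOfSurjective_apply _ _ _ _ _ _

lemma derivedExtEquiv_naturality (g : A' ⟶ A)
    (x : ((_root_.Ext R (ModuleCat.{0} R) n).obj (op A)).obj Y) :
    derivedExtEquiv A' Y n ((((_root_.Ext R (ModuleCat.{0} R) n).map g.op).app Y).hom x) =
      (Abelian.Ext.mk₀ g).comp (derivedExtEquiv A Y n x) (zero_add n) := by
  set P := CategoryTheory.projectiveResolution A
  set P' := CategoryTheory.projectiveResolution A'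
  obtain ⟨z, rfl⟩ := cocycleDerived_surjective P Y n x
  let φ : ProjectiveResolution.Hom P' P g :=
    { hom := ProjectiveResolution.lift g P' P
      hom_f_zero_comp_π_f_zero := by
        rw [← HomologicalComplex.comp_f, ProjectiveResolution.lift_commutes]; rfl }
  let Φ : homOpComplex P' Y ⟶ homOpComplex P Y :=
    ((homOp Y).mapHomologicalComplex (ComplexShape.down ℕ)).map φ.hom
  have h1 : (((_root_.Ext R (ModuleCat.{0} R) n).map g.op).app Y).hom (cocycleDerived P Y n z) =
      cocycleDerived P' Y n ((HomologicalComplex.opcyclesMap Φ n).unop.hom z) := by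
    have e1 := ProjectiveResolution.isoLeftDerivedObj_hom_naturality g P' P φ.hom
      (by simpa using φ.hom_f_zero_comp_π_f_zero) (homOp Y) n
    have e2 := HomologicalComplex.homologyι_naturality Φ n
    have e3 : ((homOp Y).leftDerived n).map g ≫ (P.isoLeftDerivedObj (homOp Y) n).hom ≫
        (homOpComplex P Y).homologyι n = (P'.isoLeftDerivedObj (homOp Y) n).hom ≫
        (homOpComplex P' Y).homologyι n ≫ HomologicalComplex.opcyclesMap Φ n := by
      refine (Category.assoc _ _ _).symm.trans ((congrArg (· ≫ _) e1).trans
        ((Category.assoc _ _ _).trans (congrArg (_ ≫ ·) e2)))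
    exact congrArg (fun f => f.unop.hom z) e3
  rw [h1, derivedExtEquiv_cocycle, derivedExtEquiv_cocycle]
  change P'.extMk _ _ rfl (d_comp_cocycleHom P' Y n _) =
    (Abelian.Ext.mk₀ g).comp (P.extMk _ _ rfl (d_comp_cocycleHom P Y n z)) _
  rw [ProjectiveResolution.mk₀_comp_extMk _ _ _ _ φ]
  congr 1
  have e4 := HomologicalComplex.p_opcyclesMap Φ n
  exact congrArg (fun f => f.unop.hom z) e4

end ModuleCat

namespace ModuleCat

open Abelian

variable {R : Type} [CommRing R] (J : Ideal R)

/-- The module `R ⧸ J ^ n`. -/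
abbrev quotPow (n : ℕ) : ModuleCat.{0} R := ModuleCat.of R (R ⧸ J ^ n)

/-- The projection `R ⧸ J ^ n ⟶ R ⧸ J ^ m` for `m ≤ n`. -/
def quotPowMap {m n : ℕ} (h : m ≤ n) : quotPow J n ⟶ quotPow J m :=
  ModuleCat.ofHom (Submodule.mapQ _ _ LinearMap.id (Ideal.pow_le_pow_right h))

@[simp] lemma quotPowMap_self (n : ℕ) : quotPowMap J (le_refl n) = 𝟙 _ := by
  refine ModuleCat.hom_ext (LinearMap.ext fun x => ?_)
  obtain ⟨x, rfl⟩ := Submodule.Quotient.mk_surjective _ x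
  rfl

@[simp] lemma quotPowMap_comp {l m n : ℕ} (h : l ≤ m) (h' : m ≤ n) :
    quotPowMap J h' ≫ quotPowMap J h = quotPowMap J (h.trans h') := by
  refine ModuleCat.hom_ext (LinearMap.ext fun x => ?_)
  obtain ⟨x, rfl⟩ := Submodule.Quotient.mk_surjective _ x
  rfl

variable (X Y Z : ModuleCat.{0} R) (i : ℕ)

/-- The transition map `Ext (R ⧸ J ^ m) X ⟶ Ext (R ⧸ J ^ n) X` for `m ≤ n`. -/
noncomputable def extTransition (m n : ℕ) (h : m ≤ n) :
    Ext.{0} (quotPow J m) X i →ₗ[R] Ext.{0} (quotPow J n) X i :=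
  Ext.precompOfLinear (Ext.mk₀ (quotPowMap J h)) R X (zero_add i)

lemma extTransition_apply (m n : ℕ) (h : m ≤ n) (a : Ext.{0} (quotPow J m) X i) :
    extTransition J X i m n h a = (Ext.mk₀ (quotPowMap J h)).comp a (zero_add i) := rfl

instance : DirectedSystem (fun n => Ext.{0} (quotPow J n) X i)
    (fun m n h => extTransition J X i m n h) where
  map_self n a := by simp [extTransition_apply]
  map_map l m n h h' a := by simp [extTransition_apply]

/-- The direct limit of the modules `Ext (R ⧸ J ^ n) X i`. -/
abbrev LimExt : Type :=
  Module.DirectLimit (fun n => Ext.{0} (quotPow J n) X i) (extTransition J X i)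

namespace LimExt

variable {X Y Z i} {J}

/-- The class in the direct limit of an extension class. -/
noncomputable abbrev of (n : ℕ) : Ext.{0} (quotPow J n) X i →ₗ[R] LimExt J X i :=
  Module.DirectLimit.of R ℕ _ (extTransition J X i) n

lemma exists_of (h : LimExt J X i) : ∃ n a, of n a = h := Module.DirectLimit.exists_of h

lemma of_precomp {m n : ℕ} (h : m ≤ n) (a : Ext.{0} (quotPow J m) X i) :
    of n ((Ext.mk₀ (quotPowMap J h)).comp a (zero_add i)) = of m a :=
  Module.DirectLimit.of_f (f := extTransition J X i) (hij := h)

lemma of_eq_zero {m : ℕ} {a : Ext.{0} (quotPow J m) X i} (ha : of m a = 0) :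
    ∃ n, ∃ h : m ≤ n, (Ext.mk₀ (quotPowMap J h)).comp a (zero_add i) = 0 :=
  Module.DirectLimit.of.zero_exact ha

/-- Composition of a class in the direct limit with an extension class. -/
noncomputable def comp {j k : ℕ} (hk : i + j = k) :
    LimExt J X i →ₗ[R] Ext.{0} X Y j →ₗ[R] LimExt J Y k :=
  Module.DirectLimit.lift R ℕ _ _
    (fun n => (Ext.bilinearCompOfLinear R (quotPow J n) X Y i j k hk).compr₂ (of n))
    (fun m n h a => by
      ext y
      change of n (((Ext.mk₀ (quotPowMap J h)).comp a (zero_add i)).comp y hk) = of m (a.comp y hk)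
      rw [Ext.comp_assoc _ _ _ _ _ (by lia), of_precomp])

@[simp] lemma of_comp {j k : ℕ} (hk : i + j = k) (n : ℕ) (a : Ext.{0} (quotPow J n) X i)
    (y : Ext.{0} X Y j) : comp hk (of n a) y = of n (a.comp y hk) := by
  simp [comp]

lemma comp_assoc {j k l m n : ℕ} (hij : i + j = l) (hjk : j + k = m) (hn : l + k = n)
    (hn' : i + m = n) (h : LimExt J X i) (y : Ext.{0} X Y j) (z : Ext.{0} Y Z k) :
    comp hn (comp hij h y) z = comp hn' h (y.comp z hjk) := by
  obtain ⟨p, a, rfl⟩ := exists_of h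
  simp only [of_comp]
  rw [Ext.comp_assoc _ _ _ _ _ (by lia)]

@[simp] lemma comp_id (h : LimExt J X i) : comp (add_zero i) h (Ext.mk₀ (𝟙 X)) = h := by
  obtain ⟨p, a, rfl⟩ := exists_of h
  simp

/-- Functoriality of the direct limit. -/
noncomputable abbrev map (f : X ⟶ Y) : LimExt J X i →ₗ[R] LimExt J Y i :=
  (comp (add_zero i)).flip (Ext.mk₀ f)

lemma map_map (f : X ⟶ Y) (g : Y ⟶ Z) (h : LimExt J X i) : map g (map f h) = map (f ≫ g) h := by
  simp only [LinearMap.flip_apply]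
  rw [comp_assoc _ (add_zero 0) _ (add_zero i), Ext.mk₀_comp_mk₀]

variable {S : ShortComplex (ModuleCat.{0} R)} (hS : S.ShortExact)
include hS

lemma exact₁ {j : ℕ} (hj : i + 1 = j) (h : LimExt J S.X₁ j) (hh : map S.f h = 0) :
    ∃ h₃ : LimExt J S.X₃ i, comp hj h₃ hS.extClass = h := by
  obtain ⟨n, a, rfl⟩ := exists_of h
  obtain ⟨m, hm, h0⟩ := of_eq_zero ((of_comp _ _ _ _).symm.trans hh)
  rw [← Ext.comp_assoc _ _ _ (zero_add j) _ (by lia)] at h0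
  obtain ⟨b, hb⟩ := Ext.covariant_sequence_exact₁ _ hS _ h0 hj
  exact ⟨of m b, by rw [of_comp, hb, of_precomp]⟩

lemma exact₂ (h : LimExt J S.X₂ i) (hh : map S.g h = 0) :
    ∃ h₁ : LimExt J S.X₁ i, map S.f h₁ = h := by
  obtain ⟨n, a, rfl⟩ := exists_of h
  obtain ⟨m, hm, h0⟩ := of_eq_zero ((of_comp _ _ _ _).symm.trans hh)
  rw [← Ext.comp_assoc _ _ _ (zero_add i) _ (by lia)] at h0
  obtain ⟨b, hb⟩ := Ext.covariant_sequence_exact₂ _ hS _ h0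
  exact ⟨of m b, by rw [LinearMap.flip_apply, of_comp, hb, of_precomp]⟩

lemma exact₃ {j : ℕ} (hj : i + 1 = j) (h : LimExt J S.X₃ i) (hh : comp hj h hS.extClass = 0) :
    ∃ h₂ : LimExt J S.X₂ i, map S.g h₂ = h := by
  obtain ⟨n, a, rfl⟩ := exists_of h
  obtain ⟨m, hm, h0⟩ := of_eq_zero ((of_comp _ _ _ _).symm.trans hh)
  rw [← Ext.comp_assoc _ _ _ (zero_add i) _ (by lia)] at h0
  obtain ⟨b, hb⟩ := Ext.covariant_sequence_exact₃ _ hS _ hj h0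
  exact ⟨of m b, by rw [LinearMap.flip_apply, of_comp, hb, of_precomp]⟩

omit hS in
lemma map_injective_of_mono (f : X ⟶ Y) [Mono f] :
    Function.Injective (map f : LimExt J X 0 →ₗ[R] LimExt J Y 0) := by
  rw [← LinearMap.ker_eq_bot, LinearMap.ker_eq_bot']
  intro h hh
  obtain ⟨n, a, rfl⟩ := exists_of h
  obtain ⟨m, hm, h0⟩ := of_eq_zero ((of_comp _ _ _ _).symm.trans hh)
  rw [← Ext.comp_assoc _ _ _ (zero_add 0) _ (by lia)] at h0
  have := Ext.postcomp_mk₀_injective_of_mono _ f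
    (a₁ := (Ext.mk₀ (quotPowMap J hm)).comp a (zero_add 0)) (a₂ := 0)
    (by simpa using h0)
  rw [← of_precomp hm, this, map_zero]

omit hS in
lemma isTorsion (h : LimExt J X i) : ∃ n, ∀ r ∈ J ^ n, r • h = 0 := by
  obtain ⟨n, a, rfl⟩ := exists_of h
  refine ⟨n, fun r hr => ?_⟩
  have : r • 𝟙 (quotPow J n) = 0 := by
    refine ModuleCat.hom_ext (LinearMap.ext fun x => ?_)
    obtain ⟨x, rfl⟩ := Submodule.Quotient.mk_surjective _ x
    exact (Submodule.Quotient.mk_eq_zero _).2 (Ideal.mul_mem_right _ _ hr)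
  rw [← map_smul, ← Ext.mk₀_id_comp a, ← Ext.smul_comp, ← Ext.mk₀_smul, this]
  simp

end LimExt

section comparison

open localCohomology Limits

/-- Local cohomology is the direct limit of `Ext (R ⧸ J ^ n) X i`. -/
lemma nonempty_localCohomology_equiv :
    Nonempty (((localCohomology J i).obj X) ≃ₗ[R] LimExt J X i) := by
  let F := diagram (idealPowersDiagram J) i
  let ev := (evaluation (ModuleCat.{0} R) (ModuleCat.{0} R)).obj X
  have : HasColimit F := hasColimitDiagram.{0, 0} (idealPowersDiagram J) i
  let c := ev.mapCocone (colimit.cocone F)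
  have hc : IsColimit c := isColimitOfPreserves ev (colimit.isColimit F)
  let o : ℕ → (ℕᵒᵖ)ᵒᵖ := fun n => op (op n)
  let q (n : ℕ) : ((F ⋙ ev).obj (o n)) ≃ₗ[R] Ext (quotPow J n) X i :=
    derivedExtEquiv (quotPow J n) X i
  have hq (m n : ℕ) (h : m ≤ n) (a : (F ⋙ ev).obj (o m)) :
      q n (((F ⋙ ev).map (homOfLE h).op.op).hom a) = extTransition J X i m n h (q m a) :=
    derivedExtEquiv_naturality (A := quotPow J m) (A' := quotPow J n) X i (quotPowMap J h) a
  have hw (m n : ℕ) (h : m ≤ n) (a : (F ⋙ ev).obj (o m)) :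
      (c.ι.app (o n)).hom (((F ⋙ ev).map (homOfLE h).op.op).hom a) = (c.ι.app (o m)).hom a :=
    congrArg (fun f => f.hom a) (c.w (homOfLE h).op.op)
  let Φ : LimExt J X i →ₗ[R] c.pt := Module.DirectLimit.lift R ℕ _ _
    (fun n => (c.ι.app (o n)).hom ∘ₗ (q n).symm.toLinearMap) (fun m n h a => by
      obtain ⟨a, rfl⟩ := (q m).surjective a
      rw [← hq]
      simpa using hw m n h a)
  refine ⟨(LinearEquiv.ofBijective Φ ⟨?_, ?_⟩).symm⟩
  · rw [← LinearMap.ker_eq_bot, LinearMap.ker_eq_bot']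
    intro h hh
    obtain ⟨n, a, rfl⟩ := LimExt.exists_of h
    obtain ⟨a, rfl⟩ := (q n).surjective a
    have h1 : (c.ι.app (o n)).hom a = (c.ι.app (o n)).hom 0 := by
      simpa [Φ] using hh
    obtain ⟨k, f, g, hfg⟩ := (Concrete.isColimit_rep_eq_iff_exists (F ⋙ ev) hc a 0).1 h1
    have hle : n ≤ k.unop.unop := leOfHom f.unop.unop
    have hf : f = (homOfLE hle).op.op := Subsingleton.elim _ _
    have h2 : ((F ⋙ ev).map f).hom a = 0 := hfg.trans (map_zero ((F ⋙ ev).map g).hom)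
    subst hf
    rw [← LimExt.of_precomp hle]
    change LimExt.of _ (extTransition J X i _ _ hle (q n a)) = 0
    rw [← hq, h2, map_zero, map_zero]
  · intro y
    obtain ⟨k, a, rfl⟩ := Concrete.isColimit_exists_rep (F ⋙ ev) hc y
    exact ⟨LimExt.of k.unop.unop (q k.unop.unop a), by simp [Φ]; rfl⟩

end comparison

end ModuleCat

namespace ModuleCat

open Abelian

variable {R : Type} [CommRing R] (J : Ideal R)

/-- The submodule of elements killed by a power of `J`. -/
def powTorsion (X : Type) [AddCommGroup X] [Module R X] : Submodule R X where
  carrier := {x | ∃ n, ∀ r ∈ J ^ n, r • x = 0}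
  zero_mem' := ⟨0, by simp⟩
  add_mem' := by
    rintro x y ⟨n, hn⟩ ⟨m, hm⟩
    refine ⟨n + m, fun r hr => ?_⟩
    rw [smul_add, hn r (Ideal.pow_le_pow_right (by lia) hr),
      hm r (Ideal.pow_le_pow_right (by lia) hr), add_zero]
  smul_mem' := by
    rintro a x ⟨n, hn⟩
    exact ⟨n, fun r hr => by rw [smul_comm, hn r hr, smul_zero]⟩

lemma map_mem_powTorsion {X Y : Type} [AddCommGroup X] [Module R X] [AddCommGroup Y] [Module R Y]
    (f : X →ₗ[R] Y) {x : X} (hx : x ∈ powTorsion J X) : f x ∈ powTorsion J Y := by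
  obtain ⟨n, hn⟩ := hx
  exact ⟨n, fun r hr => by rw [← map_smul, hn r hr, map_zero]⟩

lemma map_mem_powTorsion_iff {X Y : Type} [AddCommGroup X] [Module R X] [AddCommGroup Y]
    [Module R Y] (f : X →ₗ[R] Y) (hf : Function.Injective f) {x : X} :
    f x ∈ powTorsion J Y ↔ x ∈ powTorsion J X := by
  refine ⟨?_, map_mem_powTorsion J f⟩
  rintro ⟨n, hn⟩
  exact ⟨n, fun r hr => hf (by rw [map_smul, hn r hr, map_zero])⟩

lemma powTorsion_powTorsion {X : Type} [AddCommGroup X] [Module R X] :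
    powTorsion J (powTorsion J X) = ⊤ :=
  eq_top_iff.2 fun x _ => (map_mem_powTorsion_iff J _ (Submodule.subtype_injective _)).1 x.2

/-- Over a Noetherian ring, the torsion submodule of an injective module is injective. -/
lemma injective_powTorsion [IsNoetherianRing R] (I : Type) [AddCommGroup I] [Module R I]
    [Module.Injective R I] : Module.Injective R (powTorsion J I) := by
  refine Module.Baer.injective fun a g => ?_
  obtain ⟨n, hn⟩ : ∃ n, ∀ r ∈ J ^ n, ∀ x : a, r • g x = 0 := by
    have : (Submodule.map ((powTorsion J I).subtype ∘ₗ g) ⊤).FG :=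
      Submodule.FG.map _ (IsNoetherian.noetherian _)
    obtain ⟨s, hs⟩ := this
    have h1 : ∀ y ∈ s, y ∈ powTorsion J I := by
      intro y hy
      have : y ∈ Submodule.map ((powTorsion J I).subtype ∘ₗ g) ⊤ := hs ▸ Submodule.subset_span hy
      obtain ⟨x, -, rfl⟩ := this
      exact (g x).2
    choose! N hN using h1
    refine ⟨s.sup N, fun r hr x => Subtype.ext ?_⟩
    have hx : (g x : I) ∈ Submodule.span R (s : Set I) := by
      rw [hs]; exact ⟨x, trivial, rfl⟩
    change r • (g x : I) = 0
    generalize (g x : I) = y at hx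
    induction hx using Submodule.span_induction with
    | mem y hy => exact hN y hy r (Ideal.pow_le_pow_right (Finset.le_sup hy) hr)
    | zero => simp
    | add y z _ _ h1 h2 => rw [smul_add, h1, h2, add_zero]
    | smul c y _ h1 => rw [smul_comm, h1, smul_zero]
  obtain ⟨k, hk⟩ := Ideal.exists_pow_inf_eq_pow_smul J (M := R) a
  have hAR : ∀ x : a, (x : R) ∈ J ^ (n + k) → g x = 0 := by
    intro x hx
    have h1 : (x : R) ∈ J ^ n • (J ^ k • (⊤ : Submodule R R) ⊓ a) := by
      have := hk (n + k) (by lia)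
      rw [Nat.add_sub_cancel] at this
      rw [← this]
      exact ⟨by simpa using hx, x.2⟩
    have h2 : (x : R) ∈ J ^ n • (a : Submodule R R) := Submodule.smul_mono le_rfl inf_le_right h1
    have h3 : ∀ y (hy : y ∈ J ^ n • (a : Submodule R R)),
        g ⟨y, Submodule.smul_le_right hy⟩ = 0 := by
      intro y hy
      induction hy using Submodule.smul_induction_on' with
      | smul r hr y hy => exact (map_smul g r ⟨y, hy⟩).trans (hn r hr _)
      | add y hy z hz h1 h2 =>
        exact (map_add g ⟨y, Submodule.smul_le_right hy⟩ ⟨z, Submodule.smul_le_right hz⟩).trans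
          (by rw [h1, h2, add_zero])
    exact h3 x h2
  let φ : a →ₗ[R] R ⧸ J ^ (n + k) := (J ^ (n + k)).mkQ ∘ₗ a.subtype
  have hφ : LinearMap.ker φ ≤ LinearMap.ker ((powTorsion J I).subtype ∘ₗ g) := by
    intro x hx
    have : (x : R) ∈ J ^ (n + k) := (Submodule.Quotient.mk_eq_zero _).1 hx
    simp [hAR x this]
  obtain ⟨h, hh⟩ := Module.Injective.out ((LinearMap.ker φ).liftQ φ le_rfl)
    (LinearMap.ker_eq_bot.1 (Submodule.ker_liftQ_eq_bot _ _ _ le_rfl))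
    ((LinearMap.ker φ).liftQ _ hφ)
  have h1 : h (Submodule.Quotient.mk 1) ∈ powTorsion J I :=
    ⟨n + k, fun r hr => by
      rw [← map_smul, ← Submodule.Quotient.mk_smul, smul_eq_mul, mul_one,
        (Submodule.Quotient.mk_eq_zero _).2 hr, map_zero]⟩
  refine ⟨LinearMap.toSpanSingleton R _ ⟨_, h1⟩, fun x hx => Subtype.ext ?_⟩
  have := hh (Submodule.Quotient.mk ⟨x, hx⟩)
  rw [Submodule.liftQ_apply, Submodule.liftQ_apply] at this
  refine Eq.trans ?_ this
  change x • h (Submodule.Quotient.mk 1) = h (Submodule.Quotient.mk x)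
  rw [← map_smul, ← Submodule.Quotient.mk_smul, smul_eq_mul, mul_one]

/-- The short complex of an injection and its cokernel projection. -/
abbrev cokerComplex {X Y : Type} [AddCommGroup X] [Module R X] [AddCommGroup Y] [Module R Y]
    (f : X →ₗ[R] Y) : ShortComplex (ModuleCat.{0} R) :=
  .mk (ModuleCat.ofHom f) (ModuleCat.ofHom (LinearMap.range f).mkQ)
    (ModuleCat.hom_ext (LinearMap.ext fun x =>
      (Submodule.Quotient.mk_eq_zero _).2 (LinearMap.mem_range_self f x)))

lemma cokerComplex_shortExact {X Y : Type} [AddCommGroup X] [Module R X] [AddCommGroup Y]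
    [Module R Y] (f : X →ₗ[R] Y) (hf : Function.Injective f) : (cokerComplex f).ShortExact :=
  ModuleCat.shortComplex_shortExact _
    (fun _ => (Submodule.Quotient.mk_eq_zero (LinearMap.range f)).trans Iff.rfl) hf
    (Submodule.mkQ_surjective _)

lemma injective_of {I : Type} [AddCommGroup I] [Module R I] [Module.Injective R I] :
    Injective (ModuleCat.of R I) := Module.injective_object_of_injective_module R I

lemma exists_injective_module (X : Type) [AddCommGroup X] [Module R X] :
    ∃ (I : ModuleCat.{0} R) (f : X →ₗ[R] I), Module.Injective R I ∧ Function.Injective f := by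
  let X' := ModuleCat.of R X
  refine ⟨Injective.under X', (Injective.ι X').hom, ?_, ?_⟩
  · rw [Module.injective_iff_injective_object]
    exact Injective.injective_under X'
  · exact (ModuleCat.mono_iff_injective _).1 (inferInstance : Mono (Injective.ι X'))

namespace LimExt

variable {J} {X Y : ModuleCat.{0} R}

/-- A class in degree zero evaluated at one. -/
noncomputable def eval (X : ModuleCat.{0} R) : LimExt J X 0 →ₗ[R] X :=
  Module.DirectLimit.lift R ℕ _ _
    (fun n => { toFun a := (Ext.linearEquiv₀ (R := R) a).hom (Submodule.Quotient.mk 1)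
                map_add' := by simp
                map_smul' := by simp })
    (fun m n h a => by
      obtain ⟨a, rfl⟩ := (Ext.linearEquiv₀ (R := R)).symm.surjective a
      simp only [extTransition_apply, Ext.linearEquiv₀_symm_apply, Ext.mk₀_comp_mk₀]
      simp only [← Ext.linearEquiv₀_symm_apply (R := R), LinearMap.coe_mk, AddHom.coe_mk,
        LinearEquiv.apply_symm_apply]
      rfl)

lemma eval_of_mk₀ (n : ℕ) (f : quotPow J n ⟶ X) :
    eval X (of n (Ext.mk₀ f)) = f.hom (Submodule.Quotient.mk 1) := by
  rw [← Ext.linearEquiv₀_symm_apply (R := R)]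
  refine (Module.DirectLimit.lift_of _ _ _).trans ?_
  exact congrArg (fun f : quotPow J n ⟶ X => f.hom (Submodule.Quotient.mk 1))
    ((Ext.linearEquiv₀ (R := R)).apply_symm_apply f)

lemma exists_of_mk₀ (h : LimExt J X 0) : ∃ n f, of n (Ext.mk₀ f) = h := by
  obtain ⟨n, a, rfl⟩ := exists_of h
  obtain ⟨a, rfl⟩ := (Ext.linearEquiv₀ (R := R)).symm.surjective a
  exact ⟨n, a, by simp⟩

lemma eval_injective : Function.Injective (eval (J := J) X) := by
  rw [← LinearMap.ker_eq_bot, LinearMap.ker_eq_bot']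
  intro h hh
  obtain ⟨n, f, rfl⟩ := exists_of_mk₀ h
  rw [eval_of_mk₀] at hh
  have : f = 0 := by
    refine ModuleCat.hom_ext (LinearMap.ext fun x => ?_)
    obtain ⟨x, rfl⟩ := Submodule.Quotient.mk_surjective _ x
    have h1 : (Submodule.Quotient.mk x : R ⧸ J ^ n) = x • Submodule.Quotient.mk 1 := by
      rw [← Submodule.Quotient.mk_smul, smul_eq_mul, mul_one]
    rw [h1, map_smul]
    exact (congrArg (x • ·) hh).trans (smul_zero x)
  rw [this, Ext.mk₀_zero, map_zero]

lemma range_eval : LinearMap.range (eval (J := J) X) = powTorsion J X := by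
  apply le_antisymm
  · rintro _ ⟨h, rfl⟩
    exact map_mem_powTorsion J _ (isTorsion h)
  · rintro x ⟨n, hn⟩
    refine ⟨of n (Ext.mk₀ (ModuleCat.ofHom ((J ^ n).liftQ (LinearMap.toSpanSingleton R X x)
      fun r hr => LinearMap.mem_ker.2 (hn r hr)))), ?_⟩
    rw [eval_of_mk₀]
    exact one_smul R x

lemma eval_map (f : X ⟶ Y) (h : LimExt J X 0) : eval Y (map f h) = f.hom (eval X h) := by
  obtain ⟨n, a, rfl⟩ := exists_of_mk₀ h
  rw [LinearMap.flip_apply, of_comp, Ext.mk₀_comp_mk₀, eval_of_mk₀, eval_of_mk₀]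
  rfl

lemma subsingleton_zero (hX : powTorsion J X = ⊥) (h : LimExt J X 0) : h = 0 := by
  apply eval_injective
  have : eval X h ∈ powTorsion J X := range_eval (J := J) (X := X) ▸ LinearMap.mem_range_self _ h
  rw [hX] at this
  rw [(Submodule.mem_bot R).1 this, map_zero]

lemma eq_zero_of_injective {i : ℕ} [Injective X] (hi : i ≠ 0) (h : LimExt J X i) : h = 0 := by
  obtain ⟨i, rfl⟩ := Nat.exists_eq_succ_of_ne_zero hi
  obtain ⟨n, a, rfl⟩ := exists_of h
  rw [Ext.eq_zero_of_injective a, map_zero]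

lemma eq_zero_of_torsion [IsNoetherianRing R] (i : ℕ) (hi : i ≠ 0) :
    ∀ (X : ModuleCat.{0} R) (_ : powTorsion J X = ⊤) (h : LimExt J X i), h = 0 := by
  induction i with
  | zero => exact absurd rfl hi
  | succ i ih =>
    intro X hX h
    obtain ⟨I, f, hI, hf⟩ := exists_injective_module (R := R) X
    let f' : X →ₗ[R] powTorsion J I := f.codRestrict _ fun x =>
      map_mem_powTorsion J f (hX ▸ Submodule.mem_top)
    have hf' : Function.Injective f' := fun x y hxy => hf (congrArg Subtype.val hxy)
    have hS := cokerComplex_shortExact f' hf'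
    have := injective_powTorsion J I
    have : Injective (cokerComplex f').X₂ := injective_of
    obtain ⟨h₃, rfl⟩ := exact₁ hS rfl h (eq_zero_of_injective hi _)
    have ht : powTorsion J (cokerComplex f').X₃ = ⊤ := by
      refine eq_top_iff.2 fun x _ => ?_
      obtain ⟨x, rfl⟩ := Submodule.mkQ_surjective _ x
      apply map_mem_powTorsion
      rw [powTorsion_powTorsion]
      trivial
    by_cases hi0 : i = 0
    · subst hi0
      have hx : eval _ h₃ ∈ powTorsion J (cokerComplex f').X₃ := ht ▸ Submodule.mem_top
      obtain ⟨x, hx⟩ := Submodule.mkQ_surjective _ (eval _ h₃)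
      have : x ∈ LinearMap.range (eval (J := J) (cokerComplex f').X₂) := by
        rw [range_eval]
        change x ∈ powTorsion J (powTorsion J I)
        rw [powTorsion_powTorsion]
        trivial
      obtain ⟨h₂, rfl⟩ := this
      have : map (cokerComplex f').g h₂ = h₃ := eval_injective ((eval_map _ _).trans hx)
      rw [← this, LinearMap.flip_apply, comp_assoc _ (zero_add 1) _ rfl,
        hS.comp_extClass, map_zero]
    · rw [ih hi0 _ ht h₃, map_zero, LinearMap.zero_apply]

end LimExt

/-- A torsion-free module embeds in a torsion-free injective module. -/
lemma exists_injective_of_torsionFree [IsNoetherianRing R] (X : Type) [AddCommGroup X]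
    [Module R X] (hX : powTorsion J X = ⊥) :
    ∃ (I : ModuleCat.{0} R) (f : X →ₗ[R] I), Module.Injective R I ∧ Function.Injective f ∧
      powTorsion J I = ⊥ := by
  obtain ⟨I, f, hI, hf⟩ := exists_injective_module (R := R) X
  have := injective_powTorsion J I
  obtain ⟨r, hr⟩ := Module.Injective.out (powTorsion J I).subtype (Submodule.subtype_injective _)
    LinearMap.id
  let r' : I →ₗ[R] I := (powTorsion J I).subtype ∘ₗ r
  have hr' : ∀ x ∈ powTorsion J I, r' x = x := fun x hx => congrArg Subtype.val (hr ⟨x, hx⟩)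
  let s : I →ₗ[R] LinearMap.ker r' := (LinearMap.id - r').codRestrict _ fun x => by
    simp [hr' (r' x) (r x).2]
  have hs : ∀ x : LinearMap.ker r', s x = x := fun x => Subtype.ext (by
    change (x : I) - r' x = x
    rw [LinearMap.mem_ker.1 x.2, sub_zero])
  refine ⟨ModuleCat.of R (LinearMap.ker r'), s ∘ₗ f, ⟨?_⟩, ?_, ?_⟩
  · intro A B _ _ _ _ u hu v
    obtain ⟨h, hh⟩ := Module.Injective.out u hu ((LinearMap.ker r').subtype ∘ₗ v)
    exact ⟨s ∘ₗ h, fun x => by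
      rw [LinearMap.comp_apply, hh]
      exact hs _⟩
  · rw [← LinearMap.ker_eq_bot, LinearMap.ker_eq_bot']
    intro x hx
    have h1 : f x = r' (f x) := sub_eq_zero.1 (congrArg Subtype.val hx)
    have h2 : f x ∈ powTorsion J I := h1 ▸ (r (f x)).2
    rw [map_mem_powTorsion_iff J f hf, hX] at h2
    exact h2
  · rw [eq_bot_iff]
    intro x hx
    have h1 : (x : I) ∈ powTorsion J I := map_mem_powTorsion J (LinearMap.ker r').subtype hx
    exact Subtype.ext ((hr' _ h1).symm.trans (LinearMap.mem_ker.1 x.2))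

end ModuleCat

namespace ModuleCat

open Abelian

variable {R : Type} [CommRing R] [IsLocalRing R]

lemma powTorsion_eq_bot {X : Type} [AddCommGroup X] [Module R X]
    (h : ∀ x : X, (∀ r ∈ maximalIdeal R, r • x = 0) → x = 0) :
    powTorsion (maximalIdeal R) X = ⊥ := by
  rw [eq_bot_iff]
  rintro x ⟨n, hn⟩
  change x = 0
  induction n generalizing x with
  | zero => simpa using hn 1 (by simp)
  | succ n ih =>
    refine h x fun r hr => ih (x := r • x) fun t ht => ?_
    rw [smul_smul]
    exact hn _ (by rw [pow_succ]; exact Ideal.mul_mem_mul ht hr)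

lemma mem_powTorsion_of_smul_mem [IsNoetherianRing R] {X : Type} [AddCommGroup X] [Module R X]
    {x : X} (h : ∀ r ∈ maximalIdeal R, r • x ∈ powTorsion (maximalIdeal R) X) :
    x ∈ powTorsion (maximalIdeal R) X := by
  obtain ⟨s, hs⟩ := (IsNoetherian.noetherian (maximalIdeal R) : (maximalIdeal R).FG)
  have h' : ∀ r ∈ s, ∃ n, ∀ t ∈ maximalIdeal R ^ n, t • r • x = 0 := fun r hr =>
    h r (hs ▸ Submodule.subset_span hr)
  choose! N hN using h'
  have key : ∀ r ∈ maximalIdeal R, ∀ t ∈ maximalIdeal R ^ (s.sup N), t • r • x = 0 := by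
    intro r hr t ht
    have hr' : r ∈ Submodule.span R (s : Set R) := hs ▸ hr
    induction hr' using Submodule.span_induction with
    | mem y hy => exact hN y hy t (Ideal.pow_le_pow_right (Finset.le_sup hy) ht)
    | zero => simp
    | add y z hy hz h1 h2 =>
      rw [add_smul, smul_add, h1 (hs ▸ hy), h2 (hs ▸ hz), add_zero]
    | smul c y hy h1 => rw [smul_assoc, smul_comm, h1 (hs ▸ hy), smul_zero]
  refine ⟨s.sup N + 1, fun r hr => ?_⟩
  rw [pow_succ] at hr
  induction hr using Submodule.mul_induction_on' with
  | mem_mul_mem a ha b hb => rw [mul_smul, key b hb a ha]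
  | add a _ b _ h1 h2 => rw [add_smul, h1, h2, add_zero]

/-- The residue field as an object of the category of modules. -/
noncomputable abbrev resField (R : Type) [CommRing R] [IsLocalRing R] : ModuleCat.{0} R :=
  ModuleCat.of R (ResidueField R)

lemma residue_surj (x : ResidueField R) : ∃ r : R, r • (1 : ResidueField R) = x := by
  obtain ⟨r, rfl⟩ := residue_surjective x
  exact ⟨r, by rw [Algebra.smul_def, mul_one]; rfl⟩

lemma smul_resField {r : R} (hr : r ∈ maximalIdeal R) (x : ResidueField R) : r • x = 0 := by
  rw [Algebra.smul_def]
  have : algebraMap R (ResidueField R) r = 0 := (residue_eq_zero_iff r).2 hr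
  rw [this, zero_mul]

/-- The linear map from the residue field determined by a socle element. -/
noncomputable def ofSocle {X : Type} [AddCommGroup X] [Module R X] (x : X)
    (hx : ∀ r ∈ maximalIdeal R, r • x = 0) : ResidueField R →ₗ[R] X :=
  (maximalIdeal R).liftQ (LinearMap.toSpanSingleton R X x) hx

lemma ofSocle_smul_one {X : Type} [AddCommGroup X] [Module R X] (x : X)
    (hx : ∀ r ∈ maximalIdeal R, r • x = 0) (r : R) : ofSocle x hx (r • 1) = r • x := by
  rw [map_smul]
  exact congrArg (r • ·) (one_smul R x)

lemma eq_zero_of_ext_resField {X : ModuleCat.{0} R} (h : ∀ e : Ext (resField R) X 0, e = 0)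
    (x : X) (hx : ∀ r ∈ maximalIdeal R, r • x = 0) : x = 0 := by
  have h1 := h (Ext.mk₀ (ModuleCat.ofHom (ofSocle x hx)))
  rw [Ext.mk₀_eq_zero_iff] at h1
  have h2 := congrArg (fun f : resField R ⟶ X => f.hom ((1 : R) • (1 : ResidueField R))) h1
  exact (one_smul R x).symm.trans ((ofSocle_smul_one x hx 1).symm.trans h2)

lemma ext_resField_eq_zero {X : ModuleCat.{0} R} (hX : powTorsion (maximalIdeal R) X = ⊥)
    (e : Ext (resField R) X 0) : e = 0 := by
  obtain ⟨f, rfl⟩ := (Ext.linearEquiv₀ (R := R)).symm.surjective e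
  rw [Ext.linearEquiv₀_symm_apply, Ext.mk₀_eq_zero_iff]
  refine ModuleCat.hom_ext (LinearMap.ext fun x => ?_)
  have : f.hom x ∈ powTorsion (maximalIdeal R) X := ⟨1, fun r hr => by
    rw [← map_smul, smul_resField (by simpa using hr), map_zero]⟩
  rw [hX] at this
  exact this

namespace LimExt

variable {J : Ideal R} {S : ShortComplex (ModuleCat.{0} R)} (hS : S.ShortExact)
include hS

omit [IsLocalRing R] in
lemma bijective_comp_extClass (h₂ : ∀ i (h : LimExt J S.X₂ i), h = 0) (i : ℕ) :
    Function.Bijective fun e : LimExt J S.X₃ i => comp (rfl : i + 1 = i + 1) e hS.extClass := by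
  constructor
  · change Function.Injective ((comp (rfl : i + 1 = i + 1)).flip hS.extClass)
    rw [← LinearMap.ker_eq_bot, LinearMap.ker_eq_bot']
    intro e he
    obtain ⟨e, rfl⟩ := exact₃ hS rfl e he
    rw [h₂ _ e, map_zero]
  · intro e
    obtain ⟨e', rfl⟩ := exact₁ hS rfl e (h₂ _ _)
    exact ⟨e', rfl⟩

omit [IsLocalRing R] in
lemma bijective_comp_extClass_comp {Y : ModuleCat.{0} R} {s : ℕ} (c : Ext.{0} S.X₁ Y s)
    (h₂ : ∀ i (h : LimExt J S.X₂ i), h = 0)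
    (hc : ∀ i j (h : i + s = j), Function.Bijective fun e : LimExt J S.X₁ i => comp h e c)
    (i j : ℕ) (h : i + (s + 1) = j) :
    Function.Bijective fun e : LimExt J S.X₃ i =>
      comp h e (hS.extClass.comp c (add_comm 1 s)) := by
  have h' : (i + 1) + s = j := by lia
  convert (hc _ _ h').comp (bijective_comp_extClass hS h₂ i) using 1
  funext e
  exact (comp_assoc (rfl : i + 1 = i + 1) (add_comm 1 s) h' h e hS.extClass c).symm

end LimExt

omit [IsLocalRing R] in
lemma bijective_ext_comp_extClass {S : ShortComplex (ModuleCat.{0} R)} (hS : S.ShortExact)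
    (A : ModuleCat.{0} R) (h₂ : ∀ i (h : Ext.{0} A S.X₂ i), h = 0) (i : ℕ) :
    Function.Bijective fun e : Ext.{0} A S.X₃ i =>
      e.comp hS.extClass (rfl : i + 1 = i + 1) := by
  constructor
  · intro e e' he
    have h := map_sub (hS.extClass.postcomp A (rfl : i + 1 = i + 1)) e e'
    obtain ⟨e'', he''⟩ := Ext.covariant_sequence_exact₃ _ hS (e - e') rfl
      (h.trans (sub_eq_zero.2 he))
    rw [← sub_eq_zero, ← he'', h₂ _ e'', Ext.zero_comp]
  · intro e
    exact Ext.covariant_sequence_exact₁ _ hS e (h₂ _ _) rfl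

omit [IsLocalRing R] in
lemma bijective_ext_comp_extClass_comp {S : ShortComplex (ModuleCat.{0} R)} (hS : S.ShortExact)
    (A : ModuleCat.{0} R) {Y : ModuleCat.{0} R} {s : ℕ} (c : Ext.{0} S.X₁ Y s)
    (h₂ : ∀ i (h : Ext.{0} A S.X₂ i), h = 0)
    (hc : ∀ i j (h : i + s = j), Function.Bijective fun e : Ext.{0} A S.X₁ i => e.comp c h)
    (i j : ℕ) (h : i + (s + 1) = j) :
    Function.Bijective fun e : Ext.{0} A S.X₃ i =>
      e.comp (hS.extClass.comp c (add_comm 1 s)) h := by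
  have h' : (i + 1) + s = j := by lia
  convert (hc _ _ h').comp (bijective_ext_comp_extClass hS A h₂ i) using 1
  funext e
  exact (Ext.comp_assoc e hS.extClass c _ _ (by lia)).symm

lemma exists_shift [IsNoetherianRing R] (Y : ModuleCat.{0} R) (s : ℕ)
    (hY : ∀ i < s, ∀ e : Ext.{0} (resField R) Y i, e = 0) :
    ∃ (X : ModuleCat.{0} R) (c : Ext.{0} X Y s),
      (∀ i j (h : i + s = j), Function.Bijective
        fun e : LimExt (maximalIdeal R) X i => LimExt.comp h e c) ∧
      (∀ i j (h : i + s = j), Function.Bijective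
        fun e : Ext.{0} (resField R) X i => e.comp c h) := by
  induction s with
  | zero =>
    refine ⟨Y, Ext.mk₀ (𝟙 Y), ?_, ?_⟩
    · rintro i _ rfl
      simp only [LimExt.comp_id]
      exact Function.bijective_id
    · rintro i _ rfl
      simp only [Ext.comp_mk₀_id]
      exact Function.bijective_id
  | succ s ih =>
    obtain ⟨X, c, hc, hc'⟩ := ih fun i hi => hY i (by lia)
    have hX : powTorsion (maximalIdeal R) X = ⊥ := by
      refine powTorsion_eq_bot (eq_zero_of_ext_resField fun e => (hc' 0 s (by lia)).1 ?_)
      change e.comp c _ = (0 : Ext (resField R) X 0).comp c _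
      rw [Ext.zero_comp]
      exact hY s (by lia) _
    obtain ⟨I, f, hI, hf, hI0⟩ := exists_injective_of_torsionFree (maximalIdeal R) X hX
    have hS := cokerComplex_shortExact f hf
    have hinj : Injective (cokerComplex f).X₂ := injective_of
    have hL : ∀ i (h : LimExt (maximalIdeal R) (cokerComplex f).X₂ i), h = 0 := by
      intro i h
      obtain rfl | hi := eq_or_ne i 0
      · exact LimExt.subsingleton_zero hI0 h
      · exact LimExt.eq_zero_of_injective hi h
    have hE : ∀ i (h : Ext (resField R) (cokerComplex f).X₂ i), h = 0 := by
      intro i h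
      obtain _ | i := i
      · exact ext_resField_eq_zero hI0 h
      · exact Ext.eq_zero_of_injective h
    exact ⟨(cokerComplex f).X₃, hS.extClass.comp c (add_comm 1 s),
      LimExt.bijective_comp_extClass_comp hS c hL hc,
      bijective_ext_comp_extClass_comp hS (resField R) c hE hc'⟩

lemma limExt_eq_zero_of_ext [IsNoetherianRing R] (Y : ModuleCat.{0} R) (s : ℕ)
    (hY : ∀ i < s, ∀ e : Ext (resField R) Y i, e = 0) (i : ℕ) (hi : i < s)
    (h : LimExt (maximalIdeal R) Y i) : h = 0 := by
  obtain ⟨X, c, hc, hc'⟩ := exists_shift Y i fun j hj => hY j (by lia)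
  have hX : powTorsion (maximalIdeal R) X = ⊥ := by
    refine powTorsion_eq_bot (eq_zero_of_ext_resField fun e => (hc' 0 i (by lia)).1 ?_)
    change e.comp c _ = (0 : Ext (resField R) X 0).comp c _
    rw [Ext.zero_comp]
    exact hY i hi _
  obtain ⟨e, rfl⟩ := (hc 0 i (by lia)).2 h
  change LimExt.comp _ e c = 0
  rw [LimExt.subsingleton_zero hX e, map_zero, LinearMap.zero_apply]

section Hull

variable (E : Type) [AddCommGroup E] [Module R E] [hE : Module.Injective R E]
  (ι : ResidueField R →ₗ[R] E) (hι : Function.Injective ι)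
  (hess : ∀ P : Submodule R E, P ≠ ⊥ → LinearMap.range ι ⊓ P ≠ ⊥)

include hess in
lemma powTorsion_hull [IsNoetherianRing R] : powTorsion (maximalIdeal R) E = ⊤ := by
  have := injective_powTorsion (maximalIdeal R) E
  obtain ⟨r, hr⟩ := Module.Injective.out (powTorsion (maximalIdeal R) E).subtype
    (Submodule.subtype_injective _) LinearMap.id
  have hker : LinearMap.ker r = ⊥ := by
    by_contra hne
    refine hess _ hne (eq_bot_iff.2 ?_)
    rintro _ ⟨⟨x, rfl⟩, hx⟩
    have h1 : ι x ∈ powTorsion (maximalIdeal R) E := ⟨1, fun t ht => by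
      rw [← map_smul, smul_resField (by simpa using ht), map_zero]⟩
    have h2 := hr ⟨_, h1⟩
    have h3 : r (ι x) = 0 := hx
    exact congrArg Subtype.val (h2.symm.trans h3)
  refine eq_top_iff.2 fun x _ => ?_
  have : x - r x ∈ LinearMap.ker r := by
    rw [LinearMap.mem_ker, map_sub, sub_eq_zero]
    exact (hr (r x)).symm
  rw [hker, Submodule.mem_bot, sub_eq_zero] at this
  exact this ▸ (r x).2

omit hE in
include hess in
lemma socle_hull (e : E) (he : ∀ r ∈ maximalIdeal R, r • e = 0) : e ∈ LinearMap.range ι := by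
  by_cases h0 : e = 0
  · exact h0 ▸ zero_mem _
  have h1 : (Submodule.span R {e}) ≠ ⊥ := by simpa using h0
  obtain ⟨y, ⟨hy1, hy2⟩, hy0⟩ := Submodule.exists_mem_ne_zero_of_ne_bot (hess _ h1)
  obtain ⟨r, rfl⟩ := Submodule.mem_span_singleton.1 hy2
  have hr : IsUnit r := by
    by_contra hr
    exact hy0 (he r ((mem_maximalIdeal r).2 hr))
  obtain ⟨u, rfl⟩ := hr
  have := (LinearMap.range ι).smul_mem (↑u⁻¹ : R) hy1
  rwa [smul_smul, Units.inv_mul, one_smul] at this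

include hι in
/-- An injective hull of the residue field is a cogenerator. -/
lemma exists_linearMap_ne_zero {Y : Type} [AddCommGroup Y] [Module R Y] {y : Y} (hy : y ≠ 0) :
    ∃ φ : Y →ₗ[R] E, φ y ≠ 0 := by
  let s := LinearMap.toSpanSingleton R Y y
  have hs : LinearMap.ker s ≠ ⊤ := fun h => hy (by
    have : (1 : R) ∈ LinearMap.ker s := h ▸ Submodule.mem_top
    simpa [s] using this)
  obtain ⟨h, hh⟩ := Module.Injective.out ((LinearMap.ker s).liftQ s le_rfl)
    (LinearMap.ker_eq_bot.1 (Submodule.ker_liftQ_eq_bot _ _ _ le_rfl))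
    ((LinearMap.ker s).liftQ (LinearMap.toSpanSingleton R E (ι 1)) fun r hr => by
      have : r ∈ maximalIdeal R := le_maximalIdeal hs hr
      change r • ι 1 = 0
      rw [← map_smul, smul_resField this, map_zero])
  refine ⟨h, ?_⟩
  have h1 := hh (Submodule.Quotient.mk 1)
  rw [Submodule.liftQ_apply, Submodule.liftQ_apply] at h1
  have h2 : s 1 = y := one_smul R y
  rw [h2] at h1
  rw [h1]
  change (1 : R) • ι 1 ≠ 0
  rw [one_smul]
  exact fun h0 => one_ne_zero (hι (h0.trans (map_zero ι).symm))

include hι hess in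
/-- A torsion module with socle the residue field and vanishing first extensions by the residue
field is an injective hull of the residue field. -/
lemma nonempty_equiv_hull [IsNoetherianRing R] (T : ModuleCat.{0} R)
    (hT : powTorsion (maximalIdeal R) T = ⊤) (x₀ : T) (hx₀ : x₀ ≠ 0)
    (hx₀' : ∀ r ∈ maximalIdeal R, r • x₀ = 0)
    (hsoc : ∀ x : T, (∀ r ∈ maximalIdeal R, r • x = 0) → ∃ r : R, x = r • x₀)
    (hext : ∀ e : Ext (resField R) T 1, e = 0) : Nonempty (T ≃ₗ[R] E) := by
  let κ : ResidueField R →ₗ[R] T := ofSocle x₀ hx₀'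
  have hκ : ∀ r : R, κ (r • 1) = r • x₀ := ofSocle_smul_one x₀ hx₀'
  have hκi : Function.Injective κ := by
    rw [← LinearMap.ker_eq_bot, LinearMap.ker_eq_bot']
    intro x hx
    obtain ⟨r, rfl⟩ := residue_surj x
    rw [hκ] at hx
    by_cases hr : r ∈ maximalIdeal R
    · exact smul_resField hr _
    · rw [mem_maximalIdeal, mem_nonunits_iff, not_not] at hr
      exact absurd (hr.smul_eq_zero.1 hx) hx₀
  obtain ⟨Φ, hΦ⟩ := Module.Injective.out κ hκi ι
  have hΦi : Function.Injective Φ := by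
    rw [← LinearMap.ker_eq_bot]
    have h1 : powTorsion (maximalIdeal R) (LinearMap.ker Φ) = ⊥ := by
      refine powTorsion_eq_bot ?_
      rintro ⟨x, hx⟩ hx'
      obtain ⟨r, rfl⟩ := hsoc x fun r hr => congrArg Subtype.val (hx' r hr)
      have h2 : ι (r • 1) = 0 := by rw [← hΦ, hκ]; exact hx
      have h3 := hι (h2.trans (map_zero ι).symm)
      apply Subtype.ext
      change r • x₀ = 0
      rw [← hκ, h3, map_zero]
    refine eq_bot_iff.2 fun x hx => ?_
    have h2 : (⟨x, hx⟩ : LinearMap.ker Φ) ∈ powTorsion (maximalIdeal R) (LinearMap.ker Φ) :=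
      (map_mem_powTorsion_iff _ (LinearMap.ker Φ).subtype (Submodule.subtype_injective _)).1
        (hT ▸ Submodule.mem_top)
    rw [h1] at h2
    exact congrArg Subtype.val h2
  refine ⟨LinearEquiv.ofBijective Φ ⟨hΦi, ?_⟩⟩
  have hS := cokerComplex_shortExact Φ hΦi
  have hQ : powTorsion (maximalIdeal R) (E ⧸ LinearMap.range Φ) = ⊥ := by
    refine powTorsion_eq_bot fun q hq => ?_
    obtain ⟨e, he⟩ := Ext.covariant_sequence_exact₃ (resField R) hS
      (Ext.mk₀ (ModuleCat.ofHom (ofSocle q hq))) (n₁ := 1) rfl (hext _)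
    obtain ⟨e, rfl⟩ := (Ext.linearEquiv₀ (R := R)).symm.surjective e
    rw [Ext.linearEquiv₀_symm_apply, Ext.mk₀_comp_mk₀] at he
    have he' := (Ext.mk₀_bijective _ _).1 he
    have h1 : (LinearMap.range Φ).mkQ (e.hom ((1 : R) • (1 : ResidueField R))) = q := by
      have := congrArg (fun f : resField R ⟶ (cokerComplex Φ).X₃ =>
        f.hom ((1 : R) • (1 : ResidueField R))) he'
      exact this.trans ((ofSocle_smul_one q hq 1).trans (one_smul R q))
    rw [← h1]
    refine (Submodule.Quotient.mk_eq_zero _).2 ?_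
    obtain ⟨x, hx⟩ := socle_hull E ι hess (e.hom ((1 : R) • (1 : ResidueField R))) fun r hr =>
      (map_smul e.hom _ _).symm.trans
        ((congrArg e.hom (smul_resField hr _)).trans (map_zero e.hom))
    exact ⟨κ x, by rw [hΦ]; exact hx⟩
  intro e
  have h1 : (LinearMap.range Φ).mkQ e ∈ powTorsion (maximalIdeal R) (E ⧸ LinearMap.range Φ) :=
    map_mem_powTorsion _ _ (powTorsion_hull E ι hess ▸ Submodule.mem_top)
  rw [hQ] at h1
  exact (Submodule.Quotient.mk_eq_zero _).1 h1

end Hull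

end ModuleCat

namespace ModuleCat

open Abelian

variable {R : Type} [CommRing R] [IsLocalRing R]

/-- The conditions on the extensions of the residue field characterizing a canonical module. -/
structure IsCanonical (ω : ModuleCat.{0} R) (d : ℕ) : Prop where
  ext_eq_zero : ∀ i, i ≠ d → ∀ e : Ext.{0} (resField R) ω i, e = 0
  nonempty_equiv : Nonempty (Ext.{0} (resField R) ω d ≃ₗ[R] ResidueField R)

namespace IsCanonical

variable {ω : ModuleCat.{0} R} {d : ℕ} (hω : IsCanonical ω d)
include hω

lemma limExt_eq_zero [IsNoetherianRing R] (i : ℕ) (hi : i < d)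
    (h : LimExt (maximalIdeal R) ω i) : h = 0 :=
  limExt_eq_zero_of_ext ω d (fun j hj => hω.ext_eq_zero j hj.ne) i hi h

/-- The structure of the top local cohomology of a canonical module, in terms of a syzygy-like
module `X` with a class `c`. -/
lemma exists_socle [IsNoetherianRing R] : ∃ (X : ModuleCat.{0} R) (c : Ext.{0} X ω d)
    (κ : resField R ⟶ X), Mono κ ∧
    (Function.Bijective fun e : LimExt (maximalIdeal R) X 0 => LimExt.comp (zero_add d) e c) ∧
    (∀ y : Ext.{0} (resField R) ω d, ∃ r : R, y = r • (Ext.mk₀ κ).comp c (zero_add d)) ∧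
    (∀ x : X, (∀ r ∈ maximalIdeal R, r • x = 0) → ∃ r : R, x = κ.hom (r • 1)) ∧
    (∀ e : Ext.{0} (resField R) X 1, e = 0) := by
  obtain ⟨X, c, hc, hc'⟩ := exists_shift ω d fun i hi => hω.ext_eq_zero i hi.ne
  obtain ⟨φ⟩ := hω.nonempty_equiv
  obtain ⟨z, hz⟩ := (hc' 0 d (zero_add d)).2 (φ.symm 1)
  obtain ⟨κ, rfl⟩ := (Ext.mk₀_bijective _ _).2 z
  have hgen : ∀ y : Ext.{0} (resField R) ω d,
      ∃ r : R, y = r • (Ext.mk₀ κ).comp c (zero_add d) := by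
    intro y
    obtain ⟨r, hr⟩ := residue_surj (φ y)
    refine ⟨r, φ.injective ?_⟩
    rw [map_smul, show (Ext.mk₀ κ).comp c (zero_add d) = φ.symm 1 from hz, φ.apply_symm_apply, hr]
  have hκ0 : κ ≠ 0 := by
    rintro rfl
    have h1 : φ.symm 1 = 0 := by rw [← hz]; simp
    exact one_ne_zero (φ.symm.map_eq_zero_iff.1 h1)
  have hκ1 : κ.hom (1 : ResidueField R) ≠ 0 := by
    intro h0
    refine hκ0 (ModuleCat.hom_ext (LinearMap.ext fun x => ?_))
    obtain ⟨r, rfl⟩ := residue_surj x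
    rw [map_smul, h0, smul_zero]
    rfl
  refine ⟨X, c, κ, ?_, hc 0 d (zero_add d), hgen, ?_, ?_⟩
  · rw [ModuleCat.mono_iff_injective]
    change Function.Injective κ.hom
    rw [← LinearMap.ker_eq_bot, LinearMap.ker_eq_bot']
    intro x hx
    obtain ⟨r, rfl⟩ := residue_surj x
    rw [map_smul] at hx
    by_cases hr : r ∈ maximalIdeal R
    · exact smul_resField hr _
    · rw [mem_maximalIdeal, mem_nonunits_iff, not_not] at hr
      exact absurd (hr.smul_eq_zero.1 hx) hκ1
  · intro x hx
    obtain ⟨r, hr⟩ := hgen ((Ext.mk₀ (ModuleCat.ofHom (ofSocle x hx))).comp c (zero_add d))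
    rw [← Ext.smul_comp, ← Ext.mk₀_smul] at hr
    have h1 := (Ext.mk₀_bijective _ _).1 ((hc' 0 d (zero_add d)).1 hr)
    refine ⟨r, ?_⟩
    have h2 : (ofSocle x hx) ((1 : R) • 1) = (r • κ).hom ((1 : R) • 1) :=
      congrArg (fun f : resField R ⟶ X => f.hom ((1 : R) • (1 : ResidueField R))) h1
    rw [ofSocle_smul_one, one_smul] at h2
    rw [h2, one_smul, map_smul]
    rfl
  · intro e
    refine (hc' 1 (1 + d) rfl).1 ?_
    change e.comp c rfl = (0 : Ext.{0} (resField R) X 1).comp c rfl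
    rw [Ext.zero_comp]
    exact hω.ext_eq_zero _ (by lia) _

section Base

variable [IsNoetherianRing R]

/-- Injectivity in local duality for the residue field. -/
lemma eq_zero_of_comp_eq_zero (h : LimExt (maximalIdeal R) (resField R) 0)
    (hh : ∀ y : Ext.{0} (resField R) ω d, LimExt.comp (zero_add d) h y = 0) : h = 0 := by
  obtain ⟨X, c, κ, hκ, hc, -⟩ := hω.exists_socle
  refine LimExt.map_injective_of_mono κ (hc.1 ?_)
  have h1 := hh ((Ext.mk₀ κ).comp c (zero_add d))
  rw [← LimExt.comp_assoc (add_zero 0) (zero_add d) (zero_add d)] at h1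
  rw [map_zero]
  change _ = LimExt.comp (zero_add d) 0 c
  rw [map_zero, LinearMap.zero_apply]
  exact h1

/-- Surjectivity in local duality for the residue field. -/
lemma exists_comp_eq (ψ : Ext.{0} (resField R) ω d →ₗ[R] LimExt (maximalIdeal R) ω d) :
    ∃ h : LimExt (maximalIdeal R) (resField R) 0, ∀ y, ψ y = LimExt.comp (zero_add d) h y := by
  obtain ⟨X, c, κ, hκ, hc, hgen, hsoc, -⟩ := hω.exists_socle
  obtain ⟨z, hz⟩ := hc.2 (ψ ((Ext.mk₀ κ).comp c (zero_add d)))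
  change LimExt.comp (zero_add d) z c = _ at hz
  have hkill : ∀ r ∈ maximalIdeal R, r • (LimExt.eval X z : X) = 0 := by
    intro r hr
    rw [← map_smul, (hc.1 : Function.Injective _) (a₁ := r • z) (a₂ := 0), map_zero]
    change LimExt.comp (zero_add d) (r • z) c = LimExt.comp (zero_add d) 0 c
    rw [map_zero, LinearMap.zero_apply, map_smul, LinearMap.smul_apply, hz, ← map_smul,
      ← Ext.smul_comp, ← Ext.mk₀_smul, show r • κ = 0 from ?_, Ext.mk₀_zero, Ext.zero_comp,
      map_zero]
    refine ModuleCat.hom_ext (LinearMap.ext fun x => ?_)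
    change r • κ.hom x = 0
    rw [← map_smul, smul_resField hr, map_zero]
  obtain ⟨r, hr⟩ := hsoc _ hkill
  obtain ⟨h, hh⟩ : (r • 1 : ResidueField R) ∈
      LinearMap.range (LimExt.eval (J := maximalIdeal R) (resField R)) := by
    rw [LimExt.range_eval]
    exact ⟨1, fun t ht => smul_resField (by simpa using ht) _⟩
  have hzh : z = LimExt.map κ h := by
    apply LimExt.eval_injective
    rw [LimExt.eval_map, hh, hr]
  refine ⟨h, fun y => ?_⟩
  obtain ⟨s, rfl⟩ := hgen y
  rw [map_smul, map_smul, ← hz, hzh, LinearMap.flip_apply,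
    LimExt.comp_assoc (add_zero 0) (zero_add d) (zero_add d) (zero_add d)]

/-- The top local cohomology of a canonical module is an injective hull of the residue field. -/
lemma nonempty_equiv_hull (E : Type) [AddCommGroup E] [Module R E] [Module.Injective R E]
    (ι : ResidueField R →ₗ[R] E) (hι : Function.Injective ι)
    (hess : ∀ P : Submodule R E, P ≠ ⊥ → LinearMap.range ι ⊓ P ≠ ⊥) :
    Nonempty (LimExt (maximalIdeal R) ω d ≃ₗ[R] E) := by
  obtain ⟨X, c, κ, hκ, hc, hgen, hsoc, hext⟩ := hω.exists_socle
  rw [ModuleCat.mono_iff_injective] at hκ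
  have hκk : ∀ x, ∀ r ∈ maximalIdeal R, r • κ.hom x = 0 := fun x r hr => by
    rw [← map_smul, smul_resField hr, map_zero]
  let e₁ : LimExt (maximalIdeal R) X 0 ≃ₗ[R] LimExt (maximalIdeal R) ω d :=
    LinearEquiv.ofBijective ((LimExt.comp (zero_add d)).flip c) hc
  let e₂ : LimExt (maximalIdeal R) X 0 ≃ₗ[R] powTorsion (maximalIdeal R) X :=
    (LinearEquiv.ofInjective _ LimExt.eval_injective).trans
      (LinearEquiv.ofEq _ _ LimExt.range_eval)
  let x₀ : powTorsion (maximalIdeal R) X := ⟨κ.hom 1, 1, fun r hr => hκk _ r (by simpa using hr)⟩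
  have hT : ∀ e : Ext.{0} (resField R)
      (ModuleCat.of R (powTorsion (maximalIdeal R) X)) 1, e = 0 := by
    intro e
    have hS := cokerComplex_shortExact (powTorsion (maximalIdeal R) X).subtype
      (Submodule.subtype_injective _)
    obtain ⟨e', rfl⟩ := Ext.covariant_sequence_exact₁ (resField R) hS e (hext _) (n₀ := 0) rfl
    rw [ext_resField_eq_zero ?_ e', Ext.zero_comp]
    refine powTorsion_eq_bot fun q hq => ?_
    obtain ⟨x, rfl⟩ := Submodule.Quotient.mk_surjective _ q
    refine (Submodule.Quotient.mk_eq_zero _).2 ?_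
    rw [Submodule.range_subtype]
    refine mem_powTorsion_of_smul_mem fun r hr => ?_
    have := (Submodule.Quotient.mk_eq_zero _).1 (hq r hr)
    rwa [Submodule.range_subtype] at this
  obtain ⟨e₃⟩ := ModuleCat.nonempty_equiv_hull E ι hι hess
    (ModuleCat.of R (powTorsion (maximalIdeal R) X)) (powTorsion_powTorsion _) x₀
    (fun h0 => one_ne_zero (hκ ((congrArg Subtype.val h0).trans (map_zero κ.hom).symm)))
    (fun r hr => Subtype.ext (hκk _ r hr))
    (fun x hx => by
      obtain ⟨r, hr⟩ := hsoc x.1 fun r hr => congrArg Subtype.val (hx r hr)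
      exact ⟨r, Subtype.ext (hr.trans (map_smul κ.hom _ _))⟩) hT
  exact ⟨e₁.symm.trans (e₂.trans e₃)⟩

end Base

end IsCanonical

end ModuleCat

namespace ModuleCat

open Abelian

lemma exists_factor_of_ker_le {R : Type} [CommRing R] {A B H : Type} [AddCommGroup A] [Module R A]
    [AddCommGroup B] [Module R B] [AddCommGroup H] [Module R H] [Module.Injective R H]
    (φ : A →ₗ[R] H) (δ : A →ₗ[R] B) (h : ∀ a, δ a = 0 → φ a = 0) :
    ∃ φ' : B →ₗ[R] H, ∀ a, φ a = φ' (δ a) := by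
  obtain ⟨φ', hφ'⟩ := Module.Injective.out ((LinearMap.ker δ).liftQ δ le_rfl)
    (LinearMap.ker_eq_bot.1 (Submodule.ker_liftQ_eq_bot _ _ _ le_rfl))
    ((LinearMap.ker δ).liftQ φ h)
  exact ⟨φ', fun a => (hφ' (Submodule.Quotient.mk a)).symm⟩

namespace LimExt

variable {R : Type} [CommRing R] {J : Ideal R} {i j k : ℕ}

lemma map_comp {X Y Z : ModuleCat.{0} R} (f : X ⟶ Y) (hij : i + j = k) (h : LimExt J X i)
    (y : Ext.{0} Y Z j) : comp hij (map f h) y = comp hij h ((Ext.mk₀ f).comp y (zero_add j)) := by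
  rw [LinearMap.flip_apply, comp_assoc (add_zero i) (zero_add j) hij hij]

variable {S : ShortComplex (ModuleCat.{0} R)} (hS : S.ShortExact)

lemma map_comp_extClass (hj : i + 1 = j) (h : LimExt J S.X₃ i) :
    map S.f (comp hj h hS.extClass) = 0 := by
  rw [LinearMap.flip_apply, comp_assoc hj (add_zero 1) (add_zero j) hj, hS.extClass_comp]
  exact map_zero (comp hj h)

lemma map_comp_extClass_eq_zero (hj : i + 1 = j) (h : LimExt J S.X₂ i) :
    comp hj (map S.g h) hS.extClass = 0 := by
  rw [map_comp, hS.comp_extClass]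
  exact map_zero (comp hj h)

end LimExt

variable {R : Type} [CommRing R] [IsLocalRing R]

/-- Local duality for the module `X` with respect to `ω` in dimension `d`. -/
structure IsDual (ω : ModuleCat.{0} R) (d : ℕ) (X : ModuleCat.{0} R) : Prop where
  ext_eq_zero : ∀ j, d < j → ∀ y : Ext.{0} X ω j, y = 0
  eq_zero : ∀ i (h : LimExt (maximalIdeal R) X i),
    (∀ j (hij : i + j = d) (y : Ext.{0} X ω j), LimExt.comp hij h y = 0) → h = 0
  exists_comp : ∀ i j (hij : i + j = d)
    (ψ : Ext.{0} X ω j →ₗ[R] LimExt (maximalIdeal R) ω d),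
    ∃ h : LimExt (maximalIdeal R) X i, ∀ y, ψ y = LimExt.comp hij h y

namespace IsDual

variable {ω : ModuleCat.{0} R} {d : ℕ}

lemma of_resField [IsNoetherianRing R] (hω : IsCanonical ω d) : IsDual ω d (resField R) where
  ext_eq_zero j hj := hω.ext_eq_zero j hj.ne'
  eq_zero i h hh := by
    obtain rfl | hi := eq_or_ne i 0
    · exact hω.eq_zero_of_comp_eq_zero h fun y => hh d (zero_add d) y
    · exact LimExt.eq_zero_of_torsion i hi _ (eq_top_iff.2 fun x _ => ⟨1, fun t ht =>
        smul_resField (by simpa using ht) _⟩) h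
  exists_comp i j hij ψ := by
    obtain rfl | hi := eq_or_ne i 0
    · obtain rfl : d = j := by lia
      exact hω.exists_comp_eq ψ
    · refine ⟨0, fun y => ?_⟩
      rw [hω.ext_eq_zero j (by lia) y, map_zero, map_zero]

omit [IsLocalRing R] in
lemma _root_.ModuleCat.id_eq_zero {X : ModuleCat.{0} R} [Subsingleton X] : 𝟙 X = 0 :=
  ModuleCat.hom_ext (LinearMap.ext fun _ => Subsingleton.elim _ _)

lemma of_subsingleton (X : ModuleCat.{0} R) [Subsingleton X] : IsDual ω d X := by
  have hE : ∀ j (y : Ext.{0} X ω j), y = 0 := fun j y => by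
    rw [← Ext.mk₀_id_comp y, ModuleCat.id_eq_zero, Ext.mk₀_zero, Ext.zero_comp]
  refine ⟨fun j _ => hE j, fun i h _ => ?_, fun i j hij ψ => ⟨0, fun y => ?_⟩⟩
  · rw [← LimExt.comp_id h, ModuleCat.id_eq_zero, Ext.mk₀_zero, map_zero]
  · rw [hE j y, map_zero, map_zero]

variable [Module.Injective R (LimExt (maximalIdeal R) ω d)]

set_option maxHeartbeats 800000 in
lemma of_shortExact {S : ShortComplex (ModuleCat.{0} R)} (hS : S.ShortExact)
    (h₁ : IsDual ω d S.X₁) (h₃ : IsDual ω d S.X₃) : IsDual ω d S.X₂ where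
  ext_eq_zero j hj y := by
    obtain ⟨y, rfl⟩ := Ext.contravariant_sequence_exact₂ hS ω y (h₁.ext_eq_zero j hj _)
    rw [h₃.ext_eq_zero j hj y, Ext.comp_zero]
  eq_zero i h hh := by
    have hg : LimExt.map S.g h = 0 := by
      refine h₃.eq_zero i _ fun j hij y => ?_
      rw [LimExt.map_comp]
      exact hh j hij _
    obtain ⟨h, rfl⟩ := LimExt.exact₂ hS h hg
    have hh' : ∀ j (hij : i + j = d) (y : Ext.{0} S.X₂ ω j),
        LimExt.comp hij h ((Ext.mk₀ S.f).comp y (zero_add j)) = 0 := fun j hij y => by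
      rw [← LimExt.map_comp]
      exact hh j hij y
    by_cases hid : i ≤ d
    · obtain ⟨j, hij⟩ := Nat.exists_eq_add_of_le hid
      obtain ⟨φ, hφ⟩ := exists_factor_of_ker_le (LimExt.comp hij.symm h)
        (Ext.precompOfLinear hS.extClass R ω (add_comm 1 j)) fun y hy => by
          obtain ⟨y, rfl⟩ := Ext.contravariant_sequence_exact₁ hS ω y (add_comm 1 j) hy
          exact hh' j hij.symm y
      obtain _ | i := i
      · rw [h₁.eq_zero 0 h, map_zero]
        rintro j' hij' y
        obtain rfl : j = j' := by lia
        refine (hφ y).trans ?_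
        rw [h₃.ext_eq_zero (j + 1) (by lia) (Ext.precompOfLinear hS.extClass R ω _ y), map_zero]
      · obtain ⟨h', hh''⟩ := h₃.exists_comp i (j + 1) (by lia) φ
        have : h - LimExt.comp rfl h' hS.extClass = 0 := by
          refine h₁.eq_zero _ _ fun j' hij' y => ?_
          obtain rfl : j = j' := by lia
          rw [map_sub, LinearMap.sub_apply, sub_eq_zero,
            LimExt.comp_assoc rfl (add_comm 1 j) hij' (by lia)]
          exact (hφ y).trans (hh'' _)
        rw [sub_eq_zero.1 this]
        exact LimExt.map_comp_extClass hS rfl h'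
    · rw [h₁.eq_zero i h fun j hij => by lia, map_zero]
  exists_comp i j hij ψ := by
    obtain ⟨h, hh⟩ := h₃.exists_comp i j hij
      (ψ ∘ₗ Ext.precompOfLinear (Ext.mk₀ S.g) R ω (zero_add j))
    have h0 : LimExt.comp rfl h hS.extClass = 0 := by
      refine h₁.eq_zero _ _ fun j' hij' y => ?_
      rw [LimExt.comp_assoc rfl (add_comm 1 j') hij' (by lia)]
      obtain rfl : j = j' + 1 := by lia
      rw [← hh]
      change ψ ((Ext.mk₀ S.g).comp (hS.extClass.comp y _) (zero_add (j' + 1))) = 0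
      rw [hS.comp_extClass_assoc, map_zero]
    obtain ⟨h, rfl⟩ := LimExt.exact₃ hS rfl h h0
    obtain ⟨φ, hφ⟩ := exists_factor_of_ker_le (ψ - LimExt.comp hij h)
      (Ext.precompOfLinear (Ext.mk₀ S.f) R ω (zero_add j)) fun y hy => by
        obtain ⟨y, rfl⟩ := Ext.contravariant_sequence_exact₂ hS ω y hy
        rw [LinearMap.sub_apply, sub_eq_zero]
        refine (hh y).trans ?_
        rw [LimExt.map_comp]
    obtain ⟨h', hh'⟩ := h₁.exists_comp i j hij φ
    refine ⟨h + LimExt.map S.f h', fun y => ?_⟩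
    have h1 := (hφ y).trans (hh' _)
    rw [LinearMap.sub_apply, sub_eq_iff_eq_add'] at h1
    rw [h1, map_add, LinearMap.add_apply, LimExt.map_comp]
    rfl

end IsDual

end ModuleCat

namespace ModuleCat

open Abelian

variable {R : Type} [CommRing R]

lemma exists_pow_smul_eq_zero {J : Ideal R} {ω : ModuleCat.{0} R} {d : ℕ} {A : Type}
    [AddCommGroup A] [Module R A] [Module.Finite R A] (ψ : A →ₗ[R] LimExt J ω d) :
    ∃ n, ∀ r ∈ J ^ n, r • ψ = 0 := by
  obtain ⟨s, hs⟩ := (Module.Finite.fg_top : (⊤ : Submodule R A).FG)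
  have h (a : A) : ∃ n, ∀ r ∈ J ^ n, r • ψ a = 0 := LimExt.isTorsion (ψ a)
  choose N hN using h
  refine ⟨s.sup N, fun r hr => LinearMap.ext_on hs fun a ha => ?_⟩
  exact hN a r (Ideal.pow_le_pow_right (Finset.le_sup ha) hr)

lemma ext_smul_id_comp {X Y : ModuleCat.{0} R} (r : R) {j : ℕ} (y : Ext.{0} X Y j) :
    (Ext.mk₀ (r • 𝟙 X)).comp y (zero_add j) = r • y := by
  rw [Ext.mk₀_smul, Ext.smul_comp, Ext.mk₀_id_comp]

variable [IsLocalRing R]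

namespace IsDual

variable {ω : ModuleCat.{0} R} {d : ℕ}

section

variable [IsNoetherianRing R] [Module.Finite R ω]
  {X : ModuleCat.{0} R} [Module.Finite R X]

lemma ext_eq_zero_of_smul {x : R} (hx : x ∈ maximalIdeal R) {X' : ModuleCat.{0} R} {g : X ⟶ X'}
    {w : (x • 𝟙 X) ≫ g = 0} (hS : (ShortComplex.mk _ g w).ShortExact) (j : ℕ)
    (h0 : ∀ y : Ext.{0} X' ω (j + 1), y = 0) (y : Ext.{0} X ω j) : y = 0 := by
  have h1 : ∀ y : Ext.{0} X ω j, ∃ y', x • y' = y := fun y => by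
    obtain ⟨y', hy'⟩ := Ext.contravariant_sequence_exact₁ hS ω y (add_comm 1 j) (h0 _)
    exact ⟨y', (ext_smul_id_comp x y').symm.trans hy'⟩
  have h2 : (⊤ : Submodule R (Ext.{0} X ω j)) ≤ maximalIdeal R • ⊤ := fun y _ => by
    obtain ⟨y', rfl⟩ := h1 y
    exact Submodule.smul_mem_smul hx Submodule.mem_top
  have h3 := Submodule.eq_bot_of_le_smul_of_le_jacobson_bot (maximalIdeal R) ⊤
    Module.Finite.fg_top h2 (maximalIdeal_le_jacobson ⊥)
  exact (Submodule.mem_bot R).1 (h3 ▸ Submodule.mem_top)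

end

variable [Module.Injective R (LimExt (maximalIdeal R) ω d)]
  {X : ModuleCat.{0} R}

lemma exists_comp_of_smul {x : R} {X' : ModuleCat.{0} R} {g : X ⟶ X'} {w : (x • 𝟙 X) ≫ g = 0}
    (hS : (ShortComplex.mk _ g w).ShortExact) (h' : IsDual ω d X') {i j : ℕ} (hij : i + j = d)
    (ψ : Ext.{0} X ω j →ₗ[R] LimExt (maximalIdeal R) ω d) (hψ : x • ψ = 0) :
    ∃ h : LimExt (maximalIdeal R) X i, ∀ y, ψ y = LimExt.comp hij h y := by
  obtain ⟨φ, hφ⟩ := exists_factor_of_ker_le ψ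
    (Ext.precompOfLinear hS.extClass R ω (add_comm 1 j)) fun y hy => by
      obtain ⟨y, rfl⟩ := Ext.contravariant_sequence_exact₁ hS ω y (add_comm 1 j) hy
      change ψ ((Ext.mk₀ (x • 𝟙 X)).comp y (zero_add j)) = 0
      rw [ext_smul_id_comp, map_smul]
      exact LinearMap.congr_fun hψ y
  obtain _ | i := i
  · refine ⟨0, fun y => (hφ y).trans ?_⟩
    rw [h'.ext_eq_zero (j + 1) (by lia) (Ext.precompOfLinear hS.extClass R ω _ y), map_zero,
      map_zero, LinearMap.zero_apply]
  · obtain ⟨h, hh⟩ := h'.exists_comp i (j + 1) (by lia) φ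
    refine ⟨LimExt.comp rfl h hS.extClass, fun y => (hφ y).trans ((hh _).trans ?_)⟩
    exact (LimExt.comp_assoc (Y := X) rfl (add_comm 1 j) hij (by lia) h hS.extClass y).symm

set_option maxHeartbeats 400000 in
lemma eq_zero_of_smul {x : R} {X' : ModuleCat.{0} R} {g : X ⟶ X'} {w : (x • 𝟙 X) ≫ g = 0}
    (hS : (ShortComplex.mk _ g w).ShortExact) (h' : IsDual ω d X')
    (hsurj : ∀ i j (hij : i + j = d) (ψ : Ext.{0} X ω j →ₗ[R] LimExt (maximalIdeal R) ω d),
      ∃ h : LimExt (maximalIdeal R) X i, ∀ y, ψ y = LimExt.comp hij h y)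
    {i : ℕ} (h : LimExt (maximalIdeal R) X i)
    (hh : ∀ j (hij : i + j = d) (y : Ext.{0} X ω j), LimExt.comp hij h y = 0)
    (hx : x • h = 0) : h = 0 := by
  have hf : LimExt.map (x • 𝟙 X) h = 0 := by
    rw [LinearMap.flip_apply, Ext.mk₀_smul, map_smul, LimExt.comp_id, hx]
  obtain _ | i := i
  · have : Mono (x • 𝟙 X) := hS.mono_f
    exact (map_eq_zero_iff (LimExt.map (x • 𝟙 X)) (LimExt.map_injective_of_mono _)).1 hf
  · obtain ⟨h₃, rfl⟩ := LimExt.exact₁ hS rfl h hf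
    suffices ∃ h₂ : LimExt (maximalIdeal R) X i, h₃ = LimExt.map g h₂ by
      obtain ⟨h₂, rfl⟩ := this
      exact LimExt.map_comp_extClass_eq_zero hS rfl h₂
    by_cases hid : i ≤ d
    · obtain ⟨j, hij⟩ := Nat.exists_eq_add_of_le hid
      obtain ⟨φ, hφ⟩ := exists_factor_of_ker_le (LimExt.comp hij.symm h₃)
        (Ext.precompOfLinear (Ext.mk₀ g) R ω (zero_add j)) fun y hy => by
          obtain _ | j := j
          · have : Epi g := hS.epi_g
            have h0 : y = 0 := Ext.precomp_mk₀_injective_of_epi ω g (hy.trans (map_zero _).symm)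
            rw [h0, map_zero]
          · obtain ⟨y, rfl⟩ := Ext.contravariant_sequence_exact₃ hS ω y hy (add_comm 1 j)
            rw [← hh j (by lia) y]
            exact (LimExt.comp_assoc (Y := X) rfl (add_comm 1 j) (by lia) _ h₃ hS.extClass y).symm
      obtain ⟨h₂, hh₂⟩ := hsurj i j hij.symm φ
      refine ⟨h₂, ?_⟩
      rw [← sub_eq_zero]
      refine h'.eq_zero i _ fun j' hij' y => ?_
      obtain rfl : j = j' := by lia
      rw [map_sub, LinearMap.sub_apply, sub_eq_zero, LimExt.map_comp]
      exact (hφ y).trans (hh₂ _)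
    · exact ⟨0, by rw [map_zero, h'.eq_zero i h₃ fun j hij => by lia]⟩

/-- Local duality for `X` follows from local duality for the quotients of `X` by the powers
of a nonzerodivisor. -/
lemma of_smul [IsNoetherianRing R] [Module.Finite R ω] [Module.Finite R X] {x : R}
    (hx : x ∈ maximalIdeal R) (H : ∀ n ≠ 0, ∃ (X' : ModuleCat.{0} R) (g : X ⟶ X')
      (w : (x ^ n • 𝟙 X) ≫ g = 0), (ShortComplex.mk _ g w).ShortExact ∧ IsDual ω d X') :
    IsDual ω d X := by
  have hsurj (i j : ℕ) (hij : i + j = d)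
      (ψ : Ext.{0} X ω j →ₗ[R] LimExt (maximalIdeal R) ω d) :
      ∃ h : LimExt (maximalIdeal R) X i, ∀ y, ψ y = LimExt.comp hij h y := by
    obtain ⟨n, hn⟩ := exists_pow_smul_eq_zero ψ
    obtain ⟨X', g, w, hS, h'⟩ := H (n + 1) n.succ_ne_zero
    exact exists_comp_of_smul hS h' hij ψ
      (hn _ (Ideal.pow_le_pow_right n.le_succ (Ideal.pow_mem_pow hx _)))
  refine ⟨fun j hj y => ?_, fun i h hh => ?_, hsurj⟩
  · obtain ⟨X', g, w, hS, h'⟩ := H 1 one_ne_zero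
    exact ext_eq_zero_of_smul (by simpa using hx) hS j (h'.ext_eq_zero (j + 1) (by lia)) y
  · obtain ⟨n, hn⟩ := LimExt.isTorsion h
    obtain ⟨X', g, w, hS, h'⟩ := H (n + 1) n.succ_ne_zero
    exact eq_zero_of_smul hS h' hsurj h hh
      (hn _ (Ideal.pow_le_pow_right n.le_succ (Ideal.pow_mem_pow hx _)))

end IsDual

section Cyclic

variable {R : Type} [CommRing R]

/-- Multiplication by `a` as a map `R ⧸ K ⟶ R ⧸ I`. -/
def quotMul (I K : Ideal R) (a : R) (h : ∀ r, r * a ∈ I ↔ r ∈ K) :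
    ModuleCat.of R (R ⧸ K) ⟶ ModuleCat.of R (R ⧸ I) :=
  ModuleCat.ofHom (Submodule.mapQ K I (LinearMap.toSpanSingleton R R a) fun r hr => (h r).2 hr)

/-- The projection `R ⧸ I ⟶ R ⧸ (I ⊔ (a))`. -/
def quotSup (I : Ideal R) (a : R) :
    ModuleCat.of R (R ⧸ I) ⟶ ModuleCat.of R (R ⧸ (I ⊔ Ideal.span {a})) :=
  ModuleCat.ofHom (Submodule.mapQ I _ LinearMap.id le_sup_left)

lemma quotMul_comp_quotSup (I K : Ideal R) (a : R) (h : ∀ r, r * a ∈ I ↔ r ∈ K) :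
    quotMul I K a h ≫ quotSup I a = 0 := by
  refine ModuleCat.hom_ext (LinearMap.ext fun x => ?_)
  obtain ⟨x, rfl⟩ := Submodule.Quotient.mk_surjective _ x
  exact (Submodule.Quotient.mk_eq_zero _).2
    (Ideal.mul_mem_left _ _ (Ideal.mem_sup_right (Ideal.mem_span_singleton_self a)))

lemma quotMul_shortExact (I K : Ideal R) (a : R) (h : ∀ r, r * a ∈ I ↔ r ∈ K) :
    (ShortComplex.mk _ _ (quotMul_comp_quotSup I K a h)).ShortExact := by
  refine ModuleCat.shortComplex_shortExact _ ?_ ?_ ?_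
  · intro x
    obtain ⟨x, rfl⟩ := Submodule.Quotient.mk_surjective _ x
    constructor
    · intro hx
      obtain ⟨y, hy, z, hz, rfl⟩ := Submodule.mem_sup.1 ((Submodule.Quotient.mk_eq_zero _).1 hx)
      obtain ⟨r, rfl⟩ := Ideal.mem_span_singleton'.1 hz
      refine ⟨Submodule.Quotient.mk r, (Submodule.Quotient.eq _).2 ?_⟩
      change r * a - (y + r * a) ∈ I
      rw [sub_add_cancel_right]
      exact I.neg_mem hy
    · rintro ⟨y, hy⟩
      rw [← hy]
      exact congrArg (fun f => f.hom y) (quotMul_comp_quotSup I K a h)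
  · change Function.Injective (quotMul I K a h).hom
    rw [← LinearMap.ker_eq_bot, LinearMap.ker_eq_bot']
    intro x hx
    obtain ⟨x, rfl⟩ := Submodule.Quotient.mk_surjective _ x
    exact (Submodule.Quotient.mk_eq_zero _).2
      ((h x).1 ((Submodule.Quotient.mk_eq_zero _).1 hx))
  · intro x
    obtain ⟨x, rfl⟩ := Submodule.Quotient.mk_surjective _ x
    exact ⟨Submodule.Quotient.mk x, rfl⟩

lemma quotMul_self (I : Ideal R) (a : R) (h : ∀ r, r * a ∈ I ↔ r ∈ I) :
    quotMul I I a h = a • 𝟙 _ := by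
  refine ModuleCat.hom_ext (LinearMap.ext fun x => ?_)
  obtain ⟨x, rfl⟩ := Submodule.Quotient.mk_surjective _ x
  refine (Submodule.Quotient.eq _).2 ?_
  change x * a - a * x ∈ I
  rw [mul_comm, sub_self]
  exact I.zero_mem

end Cyclic

namespace IsDual

variable [IsNoetherianRing R] {ω : ModuleCat.{0} R} {d : ℕ} [Module.Finite R ω]
  (hω : IsCanonical ω d) [Module.Injective R (LimExt (maximalIdeal R) ω d)]
include hω

lemma of_quotient (I : Ideal R) : IsDual ω d (ModuleCat.of R (R ⧸ I)) := by
  refine IsNoetherian.induction (P := fun I : Ideal R => IsDual ω d (ModuleCat.of R (R ⧸ I)))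
    (fun (I : Ideal R) ih => ?_) I
  by_cases hI : I = ⊤
  · have : Subsingleton (ModuleCat.of R (R ⧸ I)) := Submodule.Quotient.subsingleton_iff.2 hI
    exact of_subsingleton _
  by_cases hp : I.IsPrime
  · by_cases hm : I = maximalIdeal R
    · subst hm
      exact of_resField hω
    obtain ⟨x, hx, hxI⟩ := SetLike.exists_of_lt (lt_of_le_of_ne (le_maximalIdeal hI) hm)
    refine of_smul (x := x) hx fun n hn => ?_
    have hxn : x ^ n ∉ I := fun h => hxI (hp.mem_of_pow_mem n h)
    have hmem : ∀ r, r * x ^ n ∈ I ↔ r ∈ I := fun r =>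
      ⟨fun h => (hp.mem_or_mem h).resolve_right hxn, fun h => I.mul_mem_right _ h⟩
    have hS := quotMul_shortExact I I (x ^ n) hmem
    have hw := quotMul_comp_quotSup I I (x ^ n) hmem
    simp only [quotMul_self] at hS hw
    exact ⟨_, _, hw, hS, ih _ (lt_of_le_of_ne le_sup_left fun h => hxn (h ▸
      Ideal.mem_sup_right (Ideal.mem_span_singleton_self _)))⟩
  · obtain ⟨a, b, hab, ha, hb⟩ : ∃ a b, a * b ∈ I ∧ a ∉ I ∧ b ∉ I := by
      by_contra! h
      exact hp ⟨hI, fun {a b} hab => or_iff_not_imp_left.2 (h a b hab)⟩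
    let K : Ideal R := Submodule.comap (LinearMap.toSpanSingleton R R b) I
    have hK : ∀ r, r * b ∈ I ↔ r ∈ K := fun r => Iff.rfl
    refine of_shortExact (quotMul_shortExact I K b hK) (ih K ?_) (ih _ ?_)
    · exact lt_of_le_of_ne (fun r hr => I.mul_mem_right b hr) fun h => ha (h ▸ hab)
    · exact lt_of_le_of_ne le_sup_left fun h => hb (h ▸
        Ideal.mem_sup_right (Ideal.mem_span_singleton_self _))

/-- Local duality over a local ring with a canonical module. -/
theorem of_finite (X : ModuleCat.{0} R) [hX : Module.Finite R X] : IsDual ω d X := by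
  refine IsNoetherianRing.induction_on_isQuotientEquivQuotientPrime R hX
    (motive := fun N _ _ _ => IsDual ω d (ModuleCat.of R N)) ?_ ?_ ?_
  · intro N _ _ _ _
    exact of_subsingleton _
  · intro N _ _ _ p e
    have : Subsingleton (ModuleCat.of R PUnit.{1}) := inferInstanceAs (Subsingleton PUnit)
    refine of_shortExact (S := ShortComplex.mk (ModuleCat.ofHom e.symm.toLinearMap)
      (0 : ModuleCat.of R N ⟶ ModuleCat.of R PUnit.{1}) Limits.comp_zero) ?_
      (of_quotient hω p.1) (of_subsingleton _)
    exact ModuleCat.shortComplex_shortExact _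
      (fun x => ⟨fun _ => e.symm.surjective x, fun _ => rfl⟩)
      e.symm.injective (fun x => ⟨0, rfl⟩)
  · intro N₁ _ _ _ N₂ _ _ _ N₃ _ _ _ f g hf hg hfg h₁ h₃
    exact of_shortExact (S := ShortComplex.mk (ModuleCat.ofHom f) (ModuleCat.ofHom g)
      (ModuleCat.hom_ext hfg.linearMap_comp_eq_zero))
      (ModuleCat.shortComplex_shortExact _ hfg hf hg) h₁ h₃

end IsDual

end ModuleCat

namespace ModuleCat

open Abelian

section Retract

variable {R : Type} [CommRing R] {J : Ideal R} {X Y : ModuleCat.{0} R} {κ : Type} [Fintype κ]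
  (a : κ → (X ⟶ Y)) (b : κ → (Y ⟶ X)) (hab : ∑ k, a k ≫ b k = 𝟙 X)
include hab

lemma limExt_eq_zero_of_sum_eq_id {i : ℕ} (hY : ∀ h : LimExt J Y i, h = 0)
    (h : LimExt J X i) : h = 0 := by
  rw [← LimExt.comp_id h, ← hab, Ext.mk₀_sum, map_sum]
  refine Finset.sum_eq_zero fun k _ => ?_
  have h1 : LimExt.map (b k) (LimExt.map (a k) h) = 0 := by rw [hY (LimExt.map (a k) h), map_zero]
  rwa [LimExt.map_map] at h1

lemma ext_eq_zero_of_sum_eq_id {Z : ModuleCat.{0} R} {j : ℕ} (hY : ∀ y : Ext.{0} Y Z j, y = 0)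
    (y : Ext.{0} X Z j) : y = 0 := by
  rw [← Ext.mk₀_id_comp y, ← hab, Ext.mk₀_sum, Ext.sum_comp]
  refine Finset.sum_eq_zero fun k _ => ?_
  rw [← Ext.mk₀_comp_mk₀, Ext.comp_assoc _ _ _ (add_zero 0) (zero_add j) (by lia),
    hY ((Ext.mk₀ (b k)).comp y (zero_add j)),
    Ext.comp_zero]

end Retract

section Isos

variable {R : Type} [CommRing R] {J : Ideal R}

lemma nonempty_limExt_equiv_of_equiv {X Y : Type} [AddCommGroup X] [Module R X] [AddCommGroup Y]
    [Module R Y] (e : X ≃ₗ[R] Y) (i : ℕ) :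
    Nonempty (LimExt J (ModuleCat.of R X) i ≃ₗ[R] LimExt J (ModuleCat.of R Y) i) := by
  refine ⟨LinearEquiv.ofLinearMap (LimExt.map e.toModuleIso.hom)
    (LimExt.map e.toModuleIso.inv) ?_ ?_⟩
  · refine LinearMap.ext fun h => ?_
    change LimExt.map _ (LimExt.map _ h) = h
    rw [LimExt.map_map, Iso.inv_hom_id]
    exact LimExt.comp_id h
  · refine LinearMap.ext fun h => ?_
    change LimExt.map _ (LimExt.map _ h) = h
    rw [LimExt.map_map, Iso.hom_inv_id]
    exact LimExt.comp_id h

variable {S : ShortComplex (ModuleCat.{0} R)} (hS : S.ShortExact)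
include hS

lemma nonempty_limExt_connecting_equiv {i j : ℕ} (hj : i + 1 = j)
    (hi : ∀ h : LimExt J S.X₂ i, h = 0) (hj' : ∀ h : LimExt J S.X₂ j, h = 0) :
    Nonempty (LimExt J S.X₃ i ≃ₗ[R] LimExt J S.X₁ j) := by
  refine ⟨LinearEquiv.ofBijective ((LimExt.comp hj).flip hS.extClass) ⟨?_, fun h => ?_⟩⟩
  · rw [← LinearMap.ker_eq_bot, LinearMap.ker_eq_bot']
    intro h hh
    obtain ⟨h, rfl⟩ := LimExt.exact₃ hS hj h hh
    rw [hi h, map_zero]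
  · exact LimExt.exact₁ hS hj h (hj' _)

lemma nonempty_limExt_map_equiv {i j : ℕ} (hj : i + 1 = j)
    (hi : ∀ h : LimExt J S.X₃ i, h = 0) (hj' : ∀ h : LimExt J S.X₃ j, h = 0) :
    Nonempty (LimExt J S.X₁ j ≃ₗ[R] LimExt J S.X₂ j) := by
  refine ⟨LinearEquiv.ofBijective (LimExt.map S.f) ⟨?_, fun h => ?_⟩⟩
  · rw [← LinearMap.ker_eq_bot, LinearMap.ker_eq_bot']
    intro h hh
    obtain ⟨h, rfl⟩ := LimExt.exact₁ hS hj h hh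
    rw [hi h, map_zero, LinearMap.zero_apply]
  · exact LimExt.exact₂ hS h (hj' _)

lemma nonempty_ext_connecting_equiv (Y : ModuleCat.{0} R) {i j : ℕ} (hj : 1 + i = j)
    (hi : ∀ y : Ext.{0} S.X₂ Y i, y = 0) (hj' : ∀ y : Ext.{0} S.X₂ Y j, y = 0) :
    Nonempty (Ext.{0} S.X₁ Y i ≃ₗ[R] Ext.{0} S.X₃ Y j) := by
  refine ⟨LinearEquiv.ofBijective (Ext.precompOfLinear hS.extClass R Y hj) ⟨?_, fun y => ?_⟩⟩
  · rw [← LinearMap.ker_eq_bot, LinearMap.ker_eq_bot']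
    intro y hy
    obtain ⟨y, rfl⟩ := Ext.contravariant_sequence_exact₁ hS Y y hj hy
    rw [hi y, Ext.comp_zero]
  · exact Ext.contravariant_sequence_exact₃ hS Y y (hj' _) hj

end Isos

section Torsion

variable {R : Type} [CommRing R] {J : Ideal R}

lemma nonempty_limExt_zero_equiv {X : ModuleCat.{0} R} (hX : powTorsion J X = ⊤) :
    Nonempty (LimExt J X 0 ≃ₗ[R] X) :=
  ⟨LinearEquiv.ofBijective (LimExt.eval X) ⟨LimExt.eval_injective, by
    rw [← LinearMap.range_eq_top, LimExt.range_eval, hX]⟩⟩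

lemma powTorsion_eq_bot_of_injective {X Y : Type} [AddCommGroup X] [Module R X]
    [AddCommGroup Y] [Module R Y] (f : X →ₗ[R] Y) (hf : Function.Injective f)
    (hY : powTorsion J Y = ⊥) : powTorsion J X = ⊥ := by
  refine eq_bot_iff.2 fun x hx => hf ?_
  have := map_mem_powTorsion J f hx
  rw [hY] at this
  exact ((Submodule.mem_bot R).1 this).trans (map_zero f).symm

lemma powTorsion_linearMap {X Y : Type} [AddCommGroup X] [Module R X]
    [AddCommGroup Y] [Module R Y] (hY : powTorsion J Y = ⊥) : powTorsion J (X →ₗ[R] Y) = ⊥ := by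
  refine eq_bot_iff.2 fun u hu => LinearMap.ext fun x => ?_
  have := map_mem_powTorsion J (LinearMap.applyₗ x) hu
  rw [hY] at this
  exact (Submodule.mem_bot R).1 this

end Torsion

variable {R : Type} [CommRing R] [IsLocalRing R] [IsNoetherianRing R]
  {ω : ModuleCat.{0} R} {d : ℕ}

omit [IsNoetherianRing R] in
lemma IsDual.ext_eq_zero_of_limExt {X : ModuleCat.{0} R} (hX : IsDual ω d X)
    (hcog : ∀ (Y : ModuleCat.{0} R) (y : Y), y ≠ 0 →
      ∃ φ : Y →ₗ[R] LimExt (maximalIdeal R) ω d, φ y ≠ 0) {i j : ℕ} (hij : i + j = d)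
    (h0 : ∀ h : LimExt (maximalIdeal R) X i, h = 0) (y : Ext.{0} X ω j) : y = 0 := by
  by_contra hy
  obtain ⟨φ, hφ⟩ := hcog (ModuleCat.of R (Ext.{0} X ω j)) y hy
  obtain ⟨h, hh⟩ := hX.exists_comp i j hij φ
  refine hφ ((hh y).trans ?_)
  rw [h0 h, map_zero, LinearMap.zero_apply]

/-- A canonical module together with the properties of its top local cohomology
derived from the existence of an injective hull of the residue field. -/
structure HasDuality (ω : ModuleCat.{0} R) (d : ℕ) : Prop where
  isCanonical : IsCanonical ω d
  finite : Module.Finite R ω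
  injective : Module.Injective R (LimExt (maximalIdeal R) ω d)
  exists_ne_zero : ∀ (Y : ModuleCat.{0} R) (y : Y), y ≠ 0 →
      ∃ φ : Y →ₗ[R] LimExt (maximalIdeal R) ω d, φ y ≠ 0

namespace HasDuality

variable (hω : HasDuality ω d)
include hω

lemma isDual (X : ModuleCat.{0} R) [Module.Finite R X] : IsDual ω d X := by
  have := hω.finite
  have := hω.injective
  exact IsDual.of_finite hω.isCanonical X

lemma ext_self_eq_zero (j : ℕ) (hj : j ≠ 0) (y : Ext.{0} ω ω j) : y = 0 := by
  have := hω.finite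
  by_cases hjd : j ≤ d
  · obtain ⟨i, hi⟩ := Nat.exists_eq_add_of_le' hjd
    exact (hω.isDual ω).ext_eq_zero_of_limExt hω.exists_ne_zero hi.symm
      (hω.isCanonical.limExt_eq_zero i (by lia)) y
  · exact (hω.isDual ω).ext_eq_zero j (by lia) y

lemma exists_eq_smul_id (u : ω →ₗ[R] ω) : ∃ r : R, u = r • LinearMap.id := by
  have := hω.finite
  by_contra! hu
  let A := Ext.{0} ω ω 0
  let u' : A := Ext.mk₀ (ModuleCat.ofHom u)
  let K : Submodule R A := R ∙ (Ext.mk₀ (𝟙 ω) : A)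
  have hu' : K.mkQ u' ≠ 0 := by
    intro h0
    obtain ⟨r, hr⟩ := Submodule.mem_span_singleton.1 ((Submodule.Quotient.mk_eq_zero K).1 h0)
    rw [← Ext.mk₀_smul] at hr
    refine hu r ?_
    have h1 := (Ext.mk₀_bijective _ _).1 hr
    exact (congrArg ModuleCat.Hom.hom h1).symm
  obtain ⟨φ, hφ⟩ := hω.exists_ne_zero (ModuleCat.of R (A ⧸ K)) _ hu'
  obtain ⟨h, hh⟩ := (hω.isDual ω).exists_comp d 0 (add_zero d) (φ ∘ₗ K.mkQ)
  have h1 : LimExt.comp (add_zero d) h (Ext.mk₀ (𝟙 ω)) = 0 := by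
    rw [← hh]
    have : K.mkQ (Ext.mk₀ (𝟙 ω) : A) = 0 :=
      (Submodule.Quotient.mk_eq_zero K).2 (Submodule.mem_span_singleton_self _)
    change φ (K.mkQ _) = 0
    rw [this, map_zero]
  rw [LimExt.comp_id] at h1
  refine hφ ((hh u').trans ?_)
  rw [h1, map_zero, LinearMap.zero_apply]

omit [IsNoetherianRing R] in
lemma eq_zero_of_smul_eq_zero (r : R) (hr : ∀ x : ω, r • x = 0) : r = 0 := by
  by_contra h0
  obtain ⟨φ, hφ⟩ := hω.exists_ne_zero (ModuleCat.of R R) r h0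
  refine hφ ?_
  have h1 : r • 𝟙 ω = 0 := ModuleCat.hom_ext (LinearMap.ext hr)
  have h2 : φ r = r • φ (1 : R) := by rw [← map_smul]; exact congrArg φ (mul_one r).symm
  rw [h2, ← LimExt.comp_id (φ (1 : R)), ← map_smul, ← Ext.mk₀_smul, h1, Ext.mk₀_zero, map_zero]

lemma limExt_ring_eq_zero (i : ℕ) (hi : i < d) (h : LimExt (maximalIdeal R) (ModuleCat.of R R) i) :
    h = 0 := by
  refine (hω.isDual (ModuleCat.of R R)).eq_zero i h fun j hij y => ?_
  have : Projective (ModuleCat.of R R) := ModuleCat.projective_of_free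
    (Module.Basis.singleton PUnit.{1} R)
  obtain _ | j := j
  · lia
  · rw [Ext.eq_zero_of_projective y, map_zero]

lemma powTorsion_eq_bot (hd : 0 < d) : powTorsion (maximalIdeal R) ω = ⊥ := by
  rw [← LimExt.range_eval, eq_bot_iff]
  rintro _ ⟨h, rfl⟩
  rw [hω.isCanonical.limExt_eq_zero 0 hd h, map_zero]
  exact zero_mem _

end HasDuality

end ModuleCat

namespace ModuleCat

open Abelian

section Dual

variable {R : Type} [CommRing R]

/-- The module of homomorphisms to `ω`. -/
abbrev dualMod (ω X : ModuleCat.{0} R) : ModuleCat.{0} R := ModuleCat.of R (X →ₗ[R] ω)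

variable (ω : ModuleCat.{0} R) (S : ShortComplex (ModuleCat.{0} R))

/-- The restriction of homomorphisms to `ω` along the first map of a short complex. -/
abbrev restr : (S.X₂ →ₗ[R] ω) →ₗ[R] (S.X₁ →ₗ[R] ω) := LinearMap.lcomp R ω S.f.hom

/-- The image of the restriction map. -/
abbrev restrImage : ModuleCat.{0} R := ModuleCat.of R (LinearMap.range (restr ω S))

variable {S} (hS : S.ShortExact)

/-- The connecting map from homomorphisms to extensions. -/
noncomputable def homToExt : (S.X₁ →ₗ[R] ω) →ₗ[R] Ext.{0} S.X₃ ω 1 :=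
  Ext.precompOfLinear hS.extClass R ω (add_zero 1) ∘ₗ
    (Ext.linearEquiv₀ (R := R)).symm.toLinearMap ∘ₗ
      (ModuleCat.homLinearEquiv (S := R)).symm.toLinearMap

lemma homToExt_apply (u : S.X₁ →ₗ[R] ω) :
    homToExt ω hS u = hS.extClass.comp (Ext.mk₀ (ModuleCat.ofHom u)) (add_zero 1) := rfl

lemma homToExt_eq_zero_iff (u : S.X₁ →ₗ[R] ω) :
    homToExt ω hS u = 0 ↔ u ∈ LinearMap.range (restr ω S) := by
  rw [homToExt_apply]
  constructor
  · intro h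
    obtain ⟨y, hy⟩ := Ext.contravariant_sequence_exact₁ hS ω _ (add_zero 1) h
    obtain ⟨v, rfl⟩ := (Ext.mk₀_bijective _ _).2 y
    rw [Ext.mk₀_comp_mk₀] at hy
    exact ⟨v.hom, congrArg ModuleCat.Hom.hom ((Ext.mk₀_bijective _ _).1 hy)⟩
  · rintro ⟨v, rfl⟩
    have : ModuleCat.ofHom (restr ω S v) = S.f ≫ ModuleCat.ofHom v := rfl
    rw [this, ← Ext.mk₀_comp_mk₀, hS.extClass_comp_assoc]

/-- The short complex relating the image of the restriction map with homomorphisms. -/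
noncomputable abbrev imageComplex : ShortComplex (ModuleCat.{0} R) :=
  ShortComplex.mk (X₁ := restrImage ω S) (X₂ := dualMod ω S.X₁)
    (X₃ := ModuleCat.of R (Ext.{0} S.X₃ ω 1))
    (ModuleCat.ofHom (LinearMap.range (restr ω S)).subtype) (ModuleCat.ofHom (homToExt ω hS))
    (ModuleCat.hom_ext (LinearMap.ext fun u => (homToExt_eq_zero_iff ω hS u.1).2 u.2))

lemma imageComplex_shortExact (h : ∀ y : Ext.{0} S.X₂ ω 1, y = 0) :
    (imageComplex ω hS).ShortExact := by
  refine ModuleCat.shortComplex_shortExact _ ?_ (Submodule.subtype_injective _) ?_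
  · intro u
    refine (homToExt_eq_zero_iff ω hS u).trans ⟨fun hu => ⟨⟨u, hu⟩, rfl⟩, ?_⟩
    rintro ⟨v, rfl⟩
    exact v.2
  · intro y
    obtain ⟨z, hz⟩ := Ext.contravariant_sequence_exact₃ hS ω y (h _) (add_zero 1)
    obtain ⟨u, rfl⟩ := (Ext.mk₀_bijective _ _).2 z
    exact ⟨u.hom, hz⟩

include hS in
lemma restr_eq_zero_iff (u : S.X₂ →ₗ[R] ω) :
    restr ω S u = 0 ↔ u ∈ LinearMap.range (LinearMap.lcomp R ω S.g.hom) := by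
  constructor
  · intro h
    obtain ⟨y, hy⟩ := Ext.contravariant_sequence_exact₂ hS ω (Ext.mk₀ (ModuleCat.ofHom u)) (by
      rw [Ext.mk₀_comp_mk₀, Ext.mk₀_eq_zero_iff]
      exact ModuleCat.hom_ext h)
    obtain ⟨v, rfl⟩ := (Ext.mk₀_bijective _ _).2 y
    rw [Ext.mk₀_comp_mk₀] at hy
    exact ⟨v.hom, congrArg ModuleCat.Hom.hom ((Ext.mk₀_bijective _ _).1 hy)⟩
  · rintro ⟨v, rfl⟩
    refine LinearMap.ext fun x => ?_
    change v (S.g.hom (S.f.hom x)) = 0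
    rw [show S.g.hom (S.f.hom x) = 0 from congrArg (fun f => f.hom x) S.zero, map_zero]

variable (S) in
/-- The short complex of homomorphisms to `ω`, corestricted to the image. -/
abbrev dualComplex : ShortComplex (ModuleCat.{0} R) :=
  ShortComplex.mk (X₁ := dualMod ω S.X₃) (X₂ := dualMod ω S.X₂) (X₃ := restrImage ω S)
    (ModuleCat.ofHom (LinearMap.lcomp R ω S.g.hom))
    (ModuleCat.ofHom (restr ω S).rangeRestrict)
    (ModuleCat.hom_ext (LinearMap.ext fun u => Subtype.ext (LinearMap.ext fun x =>
      (congrArg u (congrArg (fun f => f.hom x) S.zero)).trans (map_zero u))))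

include hS in
lemma dualComplex_shortExact : (dualComplex ω S).ShortExact := by
  refine ModuleCat.shortComplex_shortExact _ ?_ ?_ (LinearMap.surjective_rangeRestrict _)
  · intro u
    exact Iff.trans ⟨fun h => congrArg Subtype.val h, fun h => Subtype.ext h⟩
      (restr_eq_zero_iff ω hS u)
  · have := hS.epi_g
    rw [ModuleCat.epi_iff_surjective] at this
    intro u v h
    refine LinearMap.ext fun x => ?_
    obtain ⟨x, rfl⟩ := this x
    exact LinearMap.congr_fun h x

end Dual

variable {R : Type} [CommRing R] [IsLocalRing R] [IsNoetherianRing R]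
  {ω : ModuleCat.{0} R} {d : ℕ}

/-- A module acyclic for `ω` with dual of maximal depth. -/
structure IsGood (ω : ModuleCat.{0} R) (d : ℕ) (W : ModuleCat.{0} R) : Prop where
  ext_eq_zero : ∀ j, j ≠ 0 → ∀ y : Ext.{0} W ω j, y = 0
  limExt_eq_zero : ∀ i < d, ∀ h : LimExt (maximalIdeal R) (dualMod ω W) i, h = 0

namespace HasDuality

variable (hω : HasDuality ω d)
include hω

lemma isGood_of_free (W : ModuleCat.{0} R) [Module.Free R W] [Module.Finite R W] :
    IsGood ω d W := by
  have : Projective W := ModuleCat.projective_of_free (Module.Free.chooseBasis R W)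
  refine ⟨fun j hj y => ?_, fun i hi h => ?_⟩
  · obtain ⟨j, rfl⟩ := Nat.exists_eq_succ_of_ne_zero hj
    exact Ext.eq_zero_of_projective y
  · let b := Module.Free.chooseBasis R W
    refine limExt_eq_zero_of_sum_eq_id (Y := ω)
      (fun k => ModuleCat.ofHom (LinearMap.applyₗ (b k)))
      (fun k => ModuleCat.ofHom (LinearMap.smulRightₗ (b.coord k))) ?_
      (hω.isCanonical.limExt_eq_zero i hi) h
    refine ModuleCat.hom_ext (LinearMap.ext fun u => LinearMap.ext fun w => ?_)
    have : (∑ k, b.repr w k • u (b k)) = u w := by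
      conv_rhs => rw [← b.sum_repr w, map_sum]
      simp
    simpa [ModuleCat.hom_sum] using this

variable (hd : 2 ≤ d)
include hd

lemma limExt_zero_dual (X : ModuleCat.{0} R) (h : LimExt (maximalIdeal R) (dualMod ω X) 0) :
    h = 0 :=
  LimExt.subsingleton_zero (powTorsion_linearMap (hω.powTorsion_eq_bot (by lia))) h

lemma limExt_zero_restrImage (S : ShortComplex (ModuleCat.{0} R))
    (h : LimExt (maximalIdeal R) (restrImage ω S) 0) : h = 0 :=
  LimExt.subsingleton_zero (powTorsion_eq_bot_of_injective _ (Submodule.subtype_injective _)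
    (powTorsion_linearMap (hω.powTorsion_eq_bot (by lia)))) h

omit [IsLocalRing R] hω hd in
lemma _root_.ModuleCat.exists_free_shortExact (X : ModuleCat.{0} R) [Module.Finite R X] :
    ∃ (N W : ModuleCat.{0} R) (f : N ⟶ W) (g : W ⟶ X) (w : f ≫ g = 0),
      Module.Finite R N ∧ Module.Free R W ∧ Module.Finite R W ∧
        (ShortComplex.mk f g w).ShortExact := by
  obtain ⟨W, _, _, _, _, f, hf⟩ := Module.exists_finite_presentation R X
  have hS := LinearMap.shortExact_shortComplexKer hf
  exact ⟨_, _, _, _, _, inferInstanceAs (Module.Finite R (LinearMap.ker f)), ‹_›, ‹_›, hS⟩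

lemma limExt_one_dual (X : ModuleCat.{0} R) [Module.Finite R X]
    (h : LimExt (maximalIdeal R) (dualMod ω X) 1) : h = 0 := by
  obtain ⟨N, W, f, g, w, _, _, _, hS⟩ := exists_free_shortExact X
  have hT := dualComplex_shortExact ω hS
  obtain ⟨h', rfl⟩ := LimExt.exact₁ hT (zero_add 1) h ((hω.isGood_of_free W).limExt_eq_zero 1 hd _)
  obtain rfl : h' = 0 := hω.limExt_zero_restrImage hd _ h'
  exact LinearMap.map_zero₂ _ _

/-- The local cohomology of the image of the restriction map computes extensions. -/
theorem nonempty_limExt_restrImage_equiv {S : ShortComplex (ModuleCat.{0} R)} (hS : S.ShortExact)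
    [Module.Finite R S.X₁] (hW : IsGood ω d S.X₂)
    (hN : ∀ j, j ≠ 0 → powTorsion (maximalIdeal R) (Ext.{0} S.X₃ ω j) = ⊤)
    {i : ℕ} (hi : i + 1 < d) :
    Nonempty (LimExt (maximalIdeal R) (restrImage ω S) (i + 1) ≃ₗ[R] Ext.{0} S.X₃ ω (i + 1)) := by
  induction i generalizing S with
  | zero =>
    obtain ⟨e⟩ := nonempty_limExt_connecting_equiv
      (imageComplex_shortExact ω hS (hW.ext_eq_zero 1 one_ne_zero)) (zero_add 1)
      (hω.limExt_zero_dual hd S.X₁) (hω.limExt_one_dual hd S.X₁)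
    obtain ⟨e'⟩ := nonempty_limExt_zero_equiv (X := ModuleCat.of R (Ext.{0} S.X₃ ω 1))
      (hN 1 one_ne_zero)
    exact ⟨e.symm.trans e'⟩
  | succ i ih =>
    have hE (j : ℕ) (hj : j ≠ 0) (h : LimExt (maximalIdeal R)
        (ModuleCat.of R (Ext.{0} S.X₃ ω 1)) j) : h = 0 :=
      LimExt.eq_zero_of_torsion j hj _ (hN 1 one_ne_zero) h
    obtain ⟨e₁⟩ := nonempty_limExt_map_equiv
      (imageComplex_shortExact ω hS (hW.ext_eq_zero 1 one_ne_zero)) (rfl : (i + 1) + 1 = i + 1 + 1)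
      (hE (i + 1) (by lia)) (hE (i + 1 + 1) (by lia))
    obtain ⟨N, W, f, g, w, _, _, _, hS'⟩ := exists_free_shortExact S.X₁
    have hW' := hω.isGood_of_free W
    obtain ⟨e₂⟩ := nonempty_limExt_connecting_equiv (dualComplex_shortExact ω hS')
      (rfl : (i + 1) + 1 = i + 1 + 1) (hW'.limExt_eq_zero _ (by lia))
      (hW'.limExt_eq_zero _ (by lia))
    have hconn (j : ℕ) (hj : j ≠ 0) :
        Nonempty (Ext.{0} S.X₁ ω j ≃ₗ[R] Ext.{0} S.X₃ ω (j + 1)) :=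
      nonempty_ext_connecting_equiv hS ω (add_comm 1 j) (hW.ext_eq_zero j hj)
        (hW.ext_eq_zero (j + 1) (by lia))
    obtain ⟨e₃⟩ := ih hS' hW' (fun j hj => by
      obtain ⟨e⟩ := hconn j hj
      refine eq_top_iff.2 fun y _ => ?_
      refine (map_mem_powTorsion_iff _ e.toLinearMap e.injective).1 ?_
      exact (hN (j + 1) (by lia)) ▸ Submodule.mem_top) (by lia)
    obtain ⟨e₄⟩ := hconn (i + 1) (by lia)
    exact ⟨e₁.trans (e₂.symm.trans (e₃.trans e₄))⟩

end HasDuality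

end ModuleCat

namespace ModuleCat

open Abelian

variable {R : Type} [CommRing R] [IsLocalRing R]

lemma exists_pow_smul_eq_zero_of_isFiniteLength {X : Type} [AddCommGroup X] [Module R X]
    (h : IsFiniteLength R X) : ∃ n, ∀ r ∈ maximalIdeal R ^ n, ∀ x : X, r • x = 0 := by
  induction h with
  | of_subsingleton => exact ⟨0, fun _ _ _ => Subsingleton.elim _ _⟩
  | @of_simple_quotient X _ _ N hs _ ih =>
    obtain ⟨n, hn⟩ := ih
    have hann := eq_maximalIdeal (IsSimpleModule.annihilator_isMaximal (R := R) (M := X ⧸ N))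
    refine ⟨n + 1, fun r hr x => ?_⟩
    rw [pow_succ] at hr
    induction hr using Submodule.mul_induction_on' with
    | mem_mul_mem a ha b hb =>
      have hbx : b • x ∈ N := by
        rw [← Submodule.Quotient.mk_eq_zero, Submodule.Quotient.mk_smul]
        rw [← hann] at hb
        exact Module.mem_annihilator.1 hb _
      rw [mul_smul]
      exact congrArg Subtype.val (hn a ha ⟨b • x, hbx⟩)
    | add a _ b _ ha hb => rw [add_smul, ha, hb, add_zero]

lemma HasDuality.of_isCanonical [IsNoetherianRing R] {ω : ModuleCat.{0} R} [Module.Finite R ω]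
    {d : ℕ} (hω : IsCanonical ω d) (E : Type) [AddCommGroup E] [Module R E] [Module.Injective R E]
    (ι : ResidueField R →ₗ[R] E) (hι : Function.Injective ι)
    (e : LimExt (maximalIdeal R) ω d ≃ₗ[R] E) : HasDuality ω d where
  isCanonical := hω
  finite := inferInstance
  injective := ⟨fun X Y _ _ _ _ f hf g => by
    obtain ⟨h, hh⟩ := Module.Injective.out f hf (e.toLinearMap ∘ₗ g)
    refine ⟨e.symm.toLinearMap ∘ₗ h, fun x => ?_⟩
    change e.symm (h (f x)) = g x
    rw [hh]
    exact e.symm_apply_apply _⟩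
  exists_ne_zero := fun Y y hy => by
    obtain ⟨φ, hφ⟩ := exists_linearMap_ne_zero E ι hι hy
    exact ⟨e.symm.toLinearMap ∘ₗ φ, fun h => hφ (e.symm.map_eq_zero_iff.1 h)⟩

namespace HasDuality

variable {ω : ModuleCat.{0} R} {d : ℕ} (hω : HasDuality ω d)

section Tensor

open TensorProduct

variable (ω) (F : Type) [AddCommGroup F] [Module R F]

/-- A functional on `F` induces a homomorphism from `F ⊗ ω` to `ω`. -/
noncomputable def _root_.ModuleCat.dualTensor : Module.Dual R F →ₗ[R] (F ⊗[R] ω →ₗ[R] ω) :=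
  LinearMap.llcomp R _ _ _ (TensorProduct.lid R ω).toLinearMap ∘ₗ LinearMap.rTensorHom ω

variable {F}

omit [IsLocalRing R] in
lemma _root_.ModuleCat.dualTensor_tmul (α : Module.Dual R F) (x : F) (w : ω) :
    dualTensor ω F α (x ⊗ₜ w) = α x • w := rfl

variable {ω}
include hω

lemma dualTensor_eq_zero_iff {α : Module.Dual R F} : dualTensor ω F α = 0 ↔ α = 0 := by
  refine ⟨fun h => LinearMap.ext fun x => hω.eq_zero_of_smul_eq_zero _ fun w => ?_, ?_⟩
  · rw [← dualTensor_tmul, h, LinearMap.zero_apply]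
  · rintro rfl
    exact map_zero _

lemma bijective_dualTensor [IsNoetherianRing R] [Module.Free R F] [Module.Finite R F] :
    Function.Bijective (dualTensor ω F) := by
  constructor
  · rw [← LinearMap.ker_eq_bot, LinearMap.ker_eq_bot']
    exact fun α => hω.dualTensor_eq_zero_iff.1
  · intro u
    let b := Module.Free.chooseBasis R F
    choose r hr using fun k => hω.exists_eq_smul_id (u ∘ₗ TensorProduct.mk R F ω (b k))
    refine ⟨b.constr R r, TensorProduct.ext (b.ext fun k => ?_)⟩
    refine LinearMap.ext fun w => ?_
    change dualTensor ω F (b.constr R r) (b k ⊗ₜ w) = u (b k ⊗ₜ w)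
    rw [dualTensor_tmul, b.constr_basis]
    exact (LinearMap.congr_fun (hr k) w).symm

lemma isGood_tensor [IsNoetherianRing R] [Module.Free R F] [Module.Finite R F] :
    IsGood ω d (ModuleCat.of R (F ⊗[R] ω)) := by
  let b := Module.Free.chooseBasis R F
  refine ⟨fun j hj y => ?_, fun i hi h => ?_⟩
  · refine ext_eq_zero_of_sum_eq_id (Y := ω)
      (fun k => ModuleCat.ofHom (dualTensor ω F (b.coord k)))
      (fun k => ModuleCat.ofHom (TensorProduct.mk R F ω (b k))) ?_ (hω.ext_self_eq_zero j hj) y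
    refine ModuleCat.hom_ext (TensorProduct.ext' fun x w => ?_)
    have : (∑ k, b k ⊗ₜ[R] (b.repr x k • w)) = x ⊗ₜ[R] w := by
      conv_rhs => rw [← b.sum_repr x, TensorProduct.sum_tmul]
      simp [TensorProduct.smul_tmul]
    simpa [ModuleCat.hom_sum, dualTensor_tmul] using this
  · obtain ⟨e⟩ := nonempty_limExt_equiv_of_equiv (J := maximalIdeal R)
      (LinearEquiv.ofBijective _ (hω.bijective_dualTensor (F := F))) i
    have hF (h : LimExt (maximalIdeal R) (ModuleCat.of R (Module.Dual R F)) i) : h = 0 := by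
      refine limExt_eq_zero_of_sum_eq_id (Y := ModuleCat.of R R)
        (fun k => ModuleCat.ofHom (LinearMap.applyₗ (b k)))
        (fun k => ModuleCat.ofHom (LinearMap.toSpanSingleton R _ (b.coord k))) ?_
        (hω.limExt_ring_eq_zero i hi) h
      refine ModuleCat.hom_ext (LinearMap.ext fun u => LinearMap.ext fun x => ?_)
      simp [ModuleCat.hom_sum]
    exact e.symm.map_eq_zero_iff.1 (hF _)

lemma nonempty_range_dualMap_equiv [IsNoetherianRing R] {F₁ M : Type} [AddCommGroup F₁]
    [Module R F₁] [AddCommGroup M] [Module R M] [Module.Free R F] [Module.Finite R F]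
    (f : F₁ →ₗ[R] F) (g : F →ₗ[R] M) (hg : Function.Surjective g)
    (hfg : LinearMap.range f = LinearMap.ker g) :
    Nonempty (LinearMap.range f.dualMap ≃ₗ[R] restrImage ω (g.rTensor ω).shortComplexKer) := by
  let γ := LinearEquiv.ofBijective _ (hω.bijective_dualTensor (F := F))
  have hker (α : Module.Dual R F) :
      restr ω (g.rTensor ω).shortComplexKer (γ α) = 0 ↔ f.dualMap α = 0 := by
    rw [← hω.dualTensor_eq_zero_iff]
    have hex := rTensor_exact ω (LinearMap.exact_iff.2 hfg.symm) hg
    have hcomp : dualTensor ω F₁ (f.dualMap α) = dualTensor ω F α ∘ₗ f.rTensor ω :=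
      TensorProduct.ext' fun x w => rfl
    rw [hcomp]
    constructor
    · intro h
      refine LinearMap.ext fun t => ?_
      exact LinearMap.congr_fun h ⟨f.rTensor ω t, (hex _).2 ⟨t, rfl⟩⟩
    · intro h
      refine LinearMap.ext fun t => ?_
      obtain ⟨s, hs⟩ := (hex _).1 t.2
      exact (congrArg (dualTensor ω F α) hs).symm.trans (LinearMap.congr_fun h s)
  refine ⟨f.dualMap.quotKerEquivRange.symm.trans ((Submodule.Quotient.equiv _ _ γ ?_).trans
    (restr ω (g.rTensor ω).shortComplexKer).quotKerEquivRange)⟩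
  refine Submodule.ext fun u => ?_
  obtain ⟨α, rfl⟩ := γ.surjective u
  rw [LinearMap.mem_ker, hker, ← LinearMap.mem_ker]
  exact ⟨fun ⟨β, hβ, h⟩ => γ.injective h ▸ hβ, fun h => ⟨α, h, rfl⟩⟩

end Tensor

include hω

lemma powTorsion_ext_eq_top [IsNoetherianRing R] (N : ModuleCat.{0} R) [Module.Finite R N]
    (hN : ∀ i, i ≠ d → IsFiniteLength R (LimExt (maximalIdeal R) N i)) (j : ℕ) (hj : j ≠ 0) :
    powTorsion (maximalIdeal R) (Ext.{0} N ω j) = ⊤ := by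
  refine eq_top_iff.2 fun y _ => ?_
  by_cases hjd : j ≤ d
  · obtain ⟨i, hi⟩ := Nat.exists_eq_add_of_le' hjd
    obtain ⟨n, hn⟩ := exists_pow_smul_eq_zero_of_isFiniteLength (hN i (by lia))
    refine ⟨n, fun r hr => ?_⟩
    by_contra hy
    obtain ⟨φ, hφ⟩ := hω.exists_ne_zero (ModuleCat.of R (Ext.{0} N ω j)) _ hy
    obtain ⟨h, hh⟩ := (hω.isDual N).exists_comp i j hi.symm φ
    refine hφ ((hh _).trans ?_)
    rw [map_smul, ← LinearMap.smul_apply, ← map_smul, hn r hr, map_zero, LinearMap.zero_apply]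
  · rw [(hω.isDual N).ext_eq_zero j (by lia) y]
    exact zero_mem _

lemma nonempty_limExt_equiv_hom [IsNoetherianRing R] (N : ModuleCat.{0} R) [Module.Finite R N]
    {i j : ℕ} (hij : i + j = d) :
    Nonempty (LimExt (maximalIdeal R) N i ≃ₗ[R]
      (Ext.{0} N ω j →ₗ[R] LimExt (maximalIdeal R) ω d)) := by
  refine ⟨LinearEquiv.ofBijective (LimExt.comp hij) ⟨?_, fun ψ => ?_⟩⟩
  · rw [← LinearMap.ker_eq_bot, LinearMap.ker_eq_bot']
    refine fun h hh => (hω.isDual N).eq_zero i h fun j' hij' y => ?_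
    obtain rfl : j = j' := by lia
    rw [hh, LinearMap.zero_apply]
  · obtain ⟨h, hh⟩ := (hω.isDual N).exists_comp i j hij ψ
    exact ⟨h, LinearMap.ext fun y => (hh y).symm⟩

end HasDuality

end ModuleCat

/-- Over a Cohen-Macaulay Noetherian local ring of dimension `d ≥ 2` with
canonical module `ω`, let `M` be finitely generated of dimension `d` with `M ⊗_R ω`
generalized Cohen-Macaulay, and `λM = image(f*)` for a finite free presentation
`F₁ →f F₀ → M → 0`. Then for `1 ≤ i ≤ d-1`,
`H^i_𝔪(M ⊗ ω) ≅ Hom_R(H^{d-i}_𝔪(λM), E(k))` where `E(k)` is an injective hull of `k`. -/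
theorem statement12 (R : Type) [CommRing R] [IsNoetherianRing R] [IsLocalRing R]
    (d : ℕ) (hd : 2 ≤ d) (hR : isCMLocalRing R d)
    (ω : Type) [AddCommGroup ω] [Module R ω] (hω : isCanonicalModule R d ω)
    (M F₀ F₁ : Type) [AddCommGroup M] [Module R M] [Module.Finite R M]
    [AddCommGroup F₀] [Module R F₀] [Module.Free R F₀] [Module.Finite R F₀]
    [AddCommGroup F₁] [Module R F₁] [Module.Free R F₁] [Module.Finite R F₁]
    (f : F₁ →ₗ[R] F₀) (g : F₀ →ₗ[R] M) (hg : Function.Surjective g)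
    (hfg : LinearMap.range f = LinearMap.ker g)
    (hdimM : mdim R M = (d : ℕ))
    (hgCM : ∀ i : ℕ, i ≠ d → IsFiniteLength R (lcMod R i (TensorProduct R M ω)))
    (E : Type) [AddCommGroup E] [Module R E] (hE : Module.Injective R E)
    (ι : ResidueField R →ₗ[R] E) (hι : Function.Injective ι)
    (hess : ∀ P : Submodule R E, P ≠ ⊥ → LinearMap.range ι ⊓ P ≠ ⊥) :
    ∀ i : ℕ, 1 ≤ i → i ≤ d - 1 →
      Nonempty ((lcMod R i (TensorProduct R M ω)) ≃ₗ[R]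
        ((lcMod R (d - i) ↥(LinearMap.range f.dualMap)) →ₗ[R] E)) := by
  intro i hi hid
  obtain ⟨hfin, hω0, ⟨eω⟩⟩ := hω
  have hc : ModuleCat.IsCanonical (ModuleCat.of R ω) d :=
    ⟨fun i hi e => (ModuleCat.derivedExtEquiv _ _ i).symm.injective
      ((hω0 i hi).elim _ _), ⟨(ModuleCat.derivedExtEquiv _ _ d).symm.trans eω⟩⟩
  obtain ⟨e⟩ := hc.nonempty_equiv_hull E ι hι hess
  have hD := ModuleCat.HasDuality.of_isCanonical hc E ι hι e
  let N := ModuleCat.of R (TensorProduct R M ω)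
  have hext := hD.powTorsion_ext_eq_top N fun i hi =>
    (ModuleCat.nonempty_localCohomology_equiv (maximalIdeal R) N i).some.isFiniteLength (hgCM i hi)
  have hS := LinearMap.shortExact_shortComplexKer (f := g.rTensor ω)
    (LinearMap.rTensor_surjective ω hg)
  have : Module.Finite R (g.rTensor ω).shortComplexKer.X₁ :=
    inferInstanceAs (Module.Finite R (LinearMap.ker (g.rTensor ω)))
  obtain ⟨j, hj⟩ : ∃ j, d - i = j + 1 := ⟨d - i - 1, by lia⟩
  obtain ⟨e₁⟩ := ModuleCat.nonempty_localCohomology_equiv (maximalIdeal R) N i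
  obtain ⟨e₂⟩ := hD.nonempty_limExt_equiv_hom N (show i + (j + 1) = d by lia)
  obtain ⟨e₃⟩ := hD.nonempty_limExt_restrImage_equiv hd hS (hD.isGood_tensor (F := F₀)) hext
    (show j + 1 < d by lia)
  obtain ⟨e₄⟩ := hD.nonempty_range_dualMap_equiv f g hg hfg
  obtain ⟨e₅⟩ := ModuleCat.nonempty_limExt_equiv_of_equiv (J := maximalIdeal R)
    (X := LinearMap.range f.dualMap)
    (Y := LinearMap.range (ModuleCat.restr (ModuleCat.of R ω) (g.rTensor ω).shortComplexKer))
    e₄ (j + 1)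
  obtain ⟨e₆⟩ := ModuleCat.nonempty_localCohomology_equiv (maximalIdeal R)
    (ModuleCat.of R (LinearMap.range f.dualMap)) (j + 1)
  rw [hj]
  exact ⟨e₁.trans (e₂.trans (LinearEquiv.arrowCongr (e₆.trans (e₅.trans e₃)).symm e))⟩
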